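/- For any pair (ψ,κ) with κ ≥ 0 and ψ > ψ↓(κ), the nonlinear system admits exactly one solution (c₁,c₂,s) in ℝ × (0,∞) × (0,∞). -/

import Mathlib

open MeasureTheory ProbabilityTheory Filter Topology

noncomputable section

/-- Standard Gaussian measure `N(0,1)` on `ℝ`. -/
def stdGaussian : Measure ℝ := gaussianReal 0 1

/-- Expectation of `g (Y, Z₁, Z₂)` where `Z₁, Z₂` are independent standard Gaussians and
`P(Y = 1 | Z₁) = f (ρ Z₁)`. -/
def Egen (ρ : ℝ) (f : ℝ → ℝ) (g : ℝ → ℝ → ℝ → ℝ) : ℝ :=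
  ∫ z₁, ∫ z₂, (f (ρ * z₁) * g 1 z₁ z₂ + (1 - f (ρ * z₁)) * g (-1) z₁ z₂)
    ∂stdGaussian ∂stdGaussian

/-- `F_κ(c₁, c₂)`. -/
def Fk (ρ : ℝ) (f : ℝ → ℝ) (κ c₁ c₂ : ℝ) : ℝ :=
  Real.sqrt (Egen ρ f (fun y z₁ z₂ => (max (κ - c₁ * y * z₁ - c₂ * z₂) 0) ^ 2))

/-- `∂₁ F_κ(c₁, c₂)`. -/
def d1F (ρ : ℝ) (f : ℝ → ℝ) (κ c₁ c₂ : ℝ) : ℝ :=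
  -Egen ρ f (fun y z₁ z₂ => y * z₁ * max (κ - c₁ * y * z₁ - c₂ * z₂) 0) / Fk ρ f κ c₁ c₂

/-- `∂₂ F_κ(c₁, c₂)`. -/
def d2F (ρ : ℝ) (f : ℝ → ℝ) (κ c₁ c₂ : ℝ) : ℝ :=
  -Egen ρ f (fun y z₁ z₂ => z₂ * max (κ - c₁ * y * z₁ - c₂ * z₂) 0) / Fk ρ f κ c₁ c₂

/-- Separability threshold `ψ*(ρ, f)`. -/
def psiSep (ρ : ℝ) (f : ℝ → ℝ) : ℝ := ⨅ c : ℝ, (Fk ρ f 0 c 1) ^ 2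

/-- Soft-thresholding operator `prox_s(t) = sign(t) (|t| - s)₊`. -/
def prox (s t : ℝ) : ℝ := Real.sign t * max (|t| - s) 0

/-- The quantity `𝒯` in the nonlinear system, as a function of `(Λ, W, G) = ((q.1.1, q.1.2), q.2)`. -/
def Tcal (ρ : ℝ) (f : ℝ → ℝ) (ψ κ c₁ c₂ s : ℝ) (q : (ℝ × ℝ) × ℝ) : ℝ :=
  prox s (Real.sqrt q.1.1 * q.2 +
    (Real.sqrt ψ)⁻¹ * (d1F ρ f κ c₁ c₂ - c₁ * c₂⁻¹ * d2F ρ f κ c₁ c₂) * Real.sqrt q.1.1 * q.1.2)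

/-- The denominator `D := ψ^{-1/2} c₂⁻¹ ∂₂F_κ(c₁,c₂)`. -/
def Dval (ρ : ℝ) (f : ℝ → ℝ) (ψ κ c₁ c₂ : ℝ) : ℝ :=
  (Real.sqrt ψ)⁻¹ * c₂⁻¹ * d2F ρ f κ c₁ c₂

/-- The triple `(c₁, c₂, s)` solves the nonlinear system of equations. -/
def SolvesSystem (ρ : ℝ) (f : ℝ → ℝ) (ψ κ : ℝ) (μ : Measure (ℝ × ℝ)) (c₁ c₂ s : ℝ) : Prop :=
  c₁ = -∫ q, (Real.sqrt q.1.1)⁻¹ * q.1.2 * Tcal ρ f ψ κ c₁ c₂ s q / Dval ρ f ψ κ c₁ c₂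
        ∂(μ.prod stdGaussian) ∧
  c₁ ^ 2 + c₂ ^ 2
    = ∫ q, ((Real.sqrt q.1.1)⁻¹ * Tcal ρ f ψ κ c₁ c₂ s q / Dval ρ f ψ κ c₁ c₂) ^ 2
        ∂(μ.prod stdGaussian) ∧
  1 = ∫ q, |q.1.1⁻¹ * Tcal ρ f ψ κ c₁ c₂ s q / Dval ρ f ψ κ c₁ c₂| ∂(μ.prod stdGaussian)

/-- `κ⋆(ψ, ρ, μ)`. -/
def kappaStar (ρ : ℝ) (f : ℝ → ℝ) (ψ : ℝ) (μ : Measure (ℝ × ℝ)) : ℝ :=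
  sInf {κ : ℝ | 0 ≤ κ ∧ ∃ c₁ c₂ s : ℝ, 0 < c₂ ∧ 0 < s ∧ SolvesSystem ρ f ψ κ μ c₁ c₂ s ∧
    (Real.sqrt ψ)⁻¹ * (Fk ρ f κ c₁ c₂ - c₁ * d1F ρ f κ c₁ c₂ - c₂ * d2F ρ f κ c₁ c₂) - s = 0}


/-- `∂₁²F_κ`: second partial derivative of `F_κ` in its first argument. -/
def d11F (ρ : ℝ) (f : ℝ → ℝ) (κ c₁ c₂ : ℝ) : ℝ := deriv (fun t => d1F ρ f κ t c₂) c₁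

/-- `∂₂²F_κ`: second partial derivative of `F_κ` in its second argument. -/
def d22F (ρ : ℝ) (f : ℝ → ℝ) (κ c₁ c₂ : ℝ) : ℝ := deriv (fun t => d2F ρ f κ c₁ t) c₂

/-- `ζ := (∫ |λ^{-1/2} w| dμ)⁻¹`. -/
def zetaC (μ : Measure (ℝ × ℝ)) : ℝ := (∫ q, |(Real.sqrt q.1)⁻¹ * q.2| ∂μ)⁻¹

/-- `ω := (∫ (w - ζ λ^{-1/2} sign(ζ λ^{-1/2} w))² dμ)^{1/2}`. -/
def omegaC (μ : Measure (ℝ × ℝ)) : ℝ :=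
  Real.sqrt (∫ q, (q.2 - zetaC μ * (Real.sqrt q.1)⁻¹ *
    Real.sign (zetaC μ * (Real.sqrt q.1)⁻¹ * q.2)) ^ 2 ∂μ)

/-- `ψ₊(κ)`. -/
def psiPlus (ρ : ℝ) (f : ℝ → ℝ) (μ : Measure (ℝ × ℝ)) (κ : ℝ) : ℝ :=
  if 0 < d1F ρ f κ (zetaC μ) 0 then 0
  else d22F ρ f κ (zetaC μ) 0 - omegaC μ ^ 2 * d11F ρ f κ (zetaC μ) 0

/-- `ψ₋(κ)`. -/
def psiMinus (ρ : ℝ) (f : ℝ → ℝ) (μ : Measure (ℝ × ℝ)) (κ : ℝ) : ℝ :=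
  if d1F ρ f κ (-zetaC μ) 0 < 0 then 0
  else d22F ρ f κ (-zetaC μ) 0 - omegaC μ ^ 2 * d11F ρ f κ (-zetaC μ) 0

/-- `ψ↓(κ) := max{ψ*(ρ,f), ψ₊(κ), ψ₋(κ)}`. -/
def psiDown (ρ : ℝ) (f : ℝ → ℝ) (μ : Measure (ℝ × ℝ)) (κ : ℝ) : ℝ :=
  max (psiSep ρ f) (max (psiPlus ρ f μ κ) (psiMinus ρ f μ κ))

theorem exists_forall_le_of_convexOn_of_coercive {H : Type*} [NormedAddCommGroup H]
    [InnerProductSpace ℝ H] [CompleteSpace H] {K : Set H} (hKc : IsClosed K)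
    (hKn : K.Nonempty) {J : H → ℝ} (hJ : ConvexOn ℝ K J) (hJc : Continuous J) {a b : ℝ}
    (ha : 0 < a) (hcoer : ∀ x ∈ K, a * ‖x‖ - b ≤ J x) :
    ∃ x ∈ K, ∀ y ∈ K, J x ≤ J y := by
  have hbdd : BddBelow (J '' K) := by
    refine ⟨-b, ?_⟩
    rintro _ ⟨x, hx, rfl⟩
    have := hcoer x hx
    have := mul_nonneg ha.le (norm_nonneg x)
    linarith
  set m := sInf (J '' K) with hm
  let S : ℕ → Set H := fun n => {x | x ∈ K ∧ J x ≤ m + 1 / ((n : ℝ) + 1)}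
  have hSconv : ∀ n, Convex ℝ (S n) := fun n => hJ.convex_le _
  have hSclosed : ∀ n, IsClosed (S n) := fun n =>
    hKc.inter (isClosed_le hJc continuous_const)
  have hSne : ∀ n, (S n).Nonempty := by
    intro n
    have hpos : (0 : ℝ) < 1 / ((n : ℝ) + 1) := by positivity
    obtain ⟨_, ⟨x, hx, rfl⟩, hlt⟩ := exists_lt_of_csInf_lt (hKn.image J)
      (show sInf (J '' K) < m + 1 / ((n : ℝ) + 1) by linarith)
    exact ⟨x, hx, hlt.le⟩
  have hSanti : ∀ n k, n ≤ k → S k ⊆ S n := by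
    intro n k hnk x hx
    refine ⟨hx.1, hx.2.trans ?_⟩
    have : 1 / ((k : ℝ) + 1) ≤ 1 / ((n : ℝ) + 1) := by
      apply one_div_le_one_div_of_le (by positivity)
      have : (n : ℝ) ≤ k := by exact_mod_cast hnk
      linarith
    linarith
  have hproj : ∀ n, ∃ x ∈ S n, ∀ y ∈ S n, ‖x‖ ≤ ‖y‖ := by
    intro n
    obtain ⟨v, hv, hv2⟩ := exists_norm_eq_iInf_of_complete_convex (hSne n)
      (hSclosed n).isComplete (hSconv n) 0
    refine ⟨v, hv, fun y hy => ?_⟩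
    have h1 : ‖(0 : H) - v‖ ≤ ‖(0 : H) - y‖ := by
      rw [hv2]
      exact ciInf_le (f := fun w : S n => ‖(0 : H) - w‖) ⟨0, by
        rintro _ ⟨z, rfl⟩
        exact norm_nonneg _⟩ ⟨y, hy⟩
    simpa using h1
  choose x hxS hxmin using hproj
  have hpar : ∀ n k, n ≤ k → ‖x n - x k‖ ^ 2 ≤ 2 * (‖x k‖ ^ 2 - ‖x n‖ ^ 2) := by
    intro n k hnk
    have hmid : (1 / 2 : ℝ) • x n + (1 / 2 : ℝ) • x k ∈ S n :=
      hSconv n (hxS n) (hSanti n k hnk (hxS k)) (by norm_num) (by norm_num) (by norm_num)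
    have h1 := hxmin n _ hmid
    rw [← smul_add, norm_smul] at h1
    have h2 : 2 * ‖x n‖ ≤ ‖x n + x k‖ := by
      rw [Real.norm_of_nonneg (by norm_num)] at h1
      linarith
    have h3 := parallelogram_law_with_norm ℝ (x n) (x k)
    have h4 : (2 * ‖x n‖) ^ 2 ≤ ‖x n + x k‖ ^ 2 :=
      pow_le_pow_left₀ (by positivity) h2 2
    nlinarith
  have hmono : Monotone fun n => ‖x n‖ ^ 2 := by
    intro n k hnk
    have := hpar n k hnk
    have := sq_nonneg ‖x n - x k‖
    simp only
    linarith
  have hbd : BddAbove (Set.range fun n => ‖x n‖ ^ 2) := by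
    refine ⟨((m + 1 + b) / a) ^ 2, ?_⟩
    rintro _ ⟨n, rfl⟩
    have h1 := hcoer _ (hxS n).1
    have h2 := (hxS n).2
    have h3 : 1 / ((n : ℝ) + 1) ≤ 1 := by
      rw [div_le_one (by positivity)]
      have : (0 : ℝ) ≤ n := by positivity
      linarith
    apply pow_le_pow_left₀ (norm_nonneg _)
    rw [le_div_iff₀ ha]
    linarith
  have hlim := tendsto_atTop_ciSup hmono hbd
  set L := ⨆ n, ‖x n‖ ^ 2
  have hle : ∀ n, ‖x n‖ ^ 2 ≤ L := fun n => le_ciSup hbd n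
  have hcau : CauchySeq x := by
    refine cauchySeq_of_le_tendsto_0 (fun n => 2 * Real.sqrt (2 * (L - ‖x n‖ ^ 2))) ?_ ?_
    · intro n k N hn hk
      have key : ∀ j, N ≤ j → ‖x N - x j‖ ≤ Real.sqrt (2 * (L - ‖x N‖ ^ 2)) := by
        intro j hj
        apply Real.le_sqrt_of_sq_le
        have := hpar N j hj
        have := hle j
        linarith
      calc dist (x n) (x k) ≤ dist (x n) (x N) + dist (x N) (x k) := dist_triangle _ _ _
        _ ≤ _ := by
          rw [dist_comm (x n), dist_eq_norm, dist_eq_norm]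
          linarith [key n hn, key k hk]
    · have h1 : Tendsto (fun n => 2 * Real.sqrt (2 * (L - ‖x n‖ ^ 2))) atTop
          (𝓝 (2 * Real.sqrt (2 * (L - L)))) :=
        (((tendsto_const_nhds.sub hlim).const_mul 2).sqrt).const_mul 2
      simpa using h1
  obtain ⟨y, hy⟩ := cauchySeq_tendsto_of_complete hcau
  have hyS : ∀ n, y ∈ S n := fun n =>
    (hSclosed n).mem_of_tendsto hy (eventually_atTop.2 ⟨n, fun k hk => hSanti n k hk (hxS k)⟩)
  refine ⟨y, (hyS 0).1, fun z hz => ?_⟩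
  have h1 : J y ≤ m := by
    refine ge_of_tendsto' (f := fun n : ℕ => m + 1 / ((n : ℝ) + 1)) (x := atTop) ?_
      fun n => (hyS n).2
    simpa using tendsto_const_nhds.add (tendsto_one_div_add_atTop_nhds_zero_nat (𝕜 := ℝ))
  exact h1.trans (csInf_le hbdd ⟨z, hz, rfl⟩)

section PosPart

variable {Ω : Type*} [MeasurableSpace Ω] {P : Measure Ω}

theorem L2_inner_nonneg {a b : Lp ℝ 2 P} (ha : 0 ≤ a) (hb : 0 ≤ b) : 0 ≤ inner ℝ a b := by
  rw [L2.inner_def]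
  rw [← Lp.coeFn_nonneg] at ha hb
  refine integral_nonneg_of_ae ?_
  filter_upwards [ha, hb] with x h1 h2
  simpa using mul_nonneg h2 h1

theorem L2_inner_posPart_negPart (a : Lp ℝ 2 P) : inner ℝ a⁺ a⁻ = 0 := by
  rw [L2.inner_def]
  refine integral_eq_zero_of_ae ?_
  rw [posPart_def, negPart_def]
  filter_upwards [Lp.coeFn_sup a 0, Lp.coeFn_sup (-a) 0, Lp.coeFn_neg a, Lp.coeFn_zero ℝ 2 P]
    with x h1 h2 h3 h4
  simp only [h1, h2, Pi.sup_apply, h3, h4, Pi.neg_apply, Pi.zero_apply]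
  rcases le_total (a x) 0 with h | h
  · simp [sup_eq_right.2 h]
  · simp [sup_eq_right.2 (neg_nonpos.2 h)]

theorem L2_inner_posPart_self (a : Lp ℝ 2 P) : inner ℝ a⁺ a = ‖a⁺‖ ^ 2 := by
  nth_rw 2 [← posPart_sub_negPart a]
  rw [inner_sub_right, L2_inner_posPart_negPart, real_inner_self_eq_norm_sq, sub_zero]

theorem L2_inner_le_inner_posPart (a b : Lp ℝ 2 P) : inner ℝ a⁺ b ≤ inner ℝ a⁺ b⁺ := by
  nth_rw 1 [← posPart_sub_negPart b]
  rw [inner_sub_right]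
  linarith [L2_inner_nonneg (posPart_nonneg a) (negPart_nonneg b)]

theorem L2_inner_le_norm_posPart (a b : Lp ℝ 2 P) : inner ℝ a⁺ b ≤ ‖a⁺‖ * ‖b⁺‖ :=
  (L2_inner_le_inner_posPart a b).trans (real_inner_le_norm _ _)

theorem L2_norm_posPart_add_le (a b : Lp ℝ 2 P) : ‖(a + b)⁺‖ ≤ ‖a⁺‖ + ‖b⁺‖ := by
  by_contra! h
  have h0 : 0 < ‖(a + b)⁺‖ := (by positivity : 0 ≤ ‖a⁺‖ + ‖b⁺‖).trans_lt h
  have h1 := L2_inner_posPart_self (a + b)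
  rw [inner_add_right] at h1
  have h2 := L2_inner_le_norm_posPart (a + b) a
  have h3 := L2_inner_le_norm_posPart (a + b) b
  nlinarith

theorem L2_norm_posPart_smul (a : Lp ℝ 2 P) {t : ℝ} (ht : 0 ≤ t) : ‖(t • a)⁺‖ = t * ‖a⁺‖ := by
  rcases ht.eq_or_lt with rfl | ht
  · simp
  have key : ∀ (b : Lp ℝ 2 P) {u : ℝ}, 0 < u → u * ‖b⁺‖ ≤ ‖(u • b)⁺‖ := by
    intro b u hu
    rcases (norm_nonneg b⁺).eq_or_lt with h | h
    · rw [← h]; simp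
    have h1 := L2_inner_le_norm_posPart b (u • b)
    rw [inner_smul_right, L2_inner_posPart_self] at h1
    nlinarith
  refine le_antisymm ?_ (key a ht)
  have := key (t • a) (inv_pos.2 ht)
  rwa [smul_smul, inv_mul_cancel₀ ht.ne', one_smul, inv_mul_le_iff₀ ht] at this

theorem L2_hasFDerivAt_norm_posPart_sq (a : Lp ℝ 2 P) :
    HasFDerivAt (fun b : Lp ℝ 2 P => ‖b⁺‖ ^ 2) ((2 : ℝ) • innerSL ℝ a⁺) a := by
  rw [hasFDerivAt_iff_isLittleO_nhds_zero]
  refine Asymptotics.IsBigO.trans_isLittleO (g := fun d : Lp ℝ 2 P => ‖d‖ ^ 2) ?_ ?_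
  · refine Asymptotics.IsBigO.of_bound 1 (Eventually.of_forall fun d => ?_)
    have hlow : ‖a⁺‖ ^ 2 + 2 * inner ℝ a⁺ d ≤ ‖(a + d)⁺‖ ^ 2 := by
      have h1 := L2_inner_le_inner_posPart a (a + d)
      rw [inner_add_right, L2_inner_posPart_self] at h1
      have h2 := norm_sub_sq_real a⁺ (a + d)⁺
      have := sq_nonneg ‖a⁺ - (a + d)⁺‖
      linarith
    have hup : ‖(a + d)⁺‖ ^ 2 ≤ ‖a⁺‖ ^ 2 + 2 * inner ℝ a⁺ d + ‖d‖ ^ 2 := by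
      have h1 : inner ℝ (a + d)⁺ (a⁺ + d) = ‖(a + d)⁺‖ ^ 2 + inner ℝ (a + d)⁺ a⁻ := by
        rw [← L2_inner_posPart_self (a + d), ← inner_add_right]
        congr 1
        nth_rw 2 [← posPart_sub_negPart a]
        abel
      have h2 := L2_inner_nonneg (posPart_nonneg (a + d)) (negPart_nonneg a)
      have h3 := norm_sub_sq_real (a + d)⁺ (a⁺ + d)
      have h4 := norm_add_sq_real a⁺ d
      have := sq_nonneg ‖(a + d)⁺ - (a⁺ + d)‖
      linarith
    simp only [smul_apply, innerSL_apply_apply, smul_eq_mul, one_mul,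
      Real.norm_eq_abs, abs_le, abs_pow, abs_norm]
    constructor <;> linarith [sq_nonneg ‖d‖]
  · have h : (fun d : Lp ℝ 2 P => ‖d‖ ^ 2) =o[𝓝 0] fun d => ‖d‖ ^ 1 :=
      (Asymptotics.isLittleO_pow_pow (𝕜 := ℝ) (by norm_num : 1 < 2)).comp_tendsto
        (continuous_norm.tendsto' _ _ norm_zero)
    exact (h.congr_right fun d => pow_one ‖d‖).of_norm_right

theorem L2_continuous_norm_posPart : Continuous fun a : Lp ℝ 2 P => ‖a⁺‖ := by
  have h : Continuous fun a : Lp ℝ 2 P => Real.sqrt (‖a⁺‖ ^ 2) :=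
    (continuous_iff_continuousAt.2 fun a =>
      (L2_hasFDerivAt_norm_posPart_sq a).continuousAt).sqrt
  simpa using h

theorem L2_hasFDerivAt_norm_posPart {a : Lp ℝ 2 P} (ha : 0 < ‖a⁺‖) :
    HasFDerivAt (fun b : Lp ℝ 2 P => ‖b⁺‖) (‖a⁺‖⁻¹ • innerSL ℝ a⁺) a := by
  have h := (L2_hasFDerivAt_norm_posPart_sq a).sqrt (by positivity)
  simp only [Real.sqrt_sq (norm_nonneg _), smul_smul] at h
  rwa [show 1 / (2 * ‖a⁺‖) * 2 = ‖a⁺‖⁻¹ by field_simp] at h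

end PosPart

instance : IsProbabilityMeasure _root_.stdGaussian := by unfold _root_.stdGaussian; infer_instance

instance : _root_.stdGaussian.IsOpenPosMeasure :=
  (gaussianReal_absolutelyContinuous' 0 one_ne_zero).isOpenPosMeasure

theorem stdGaussian_map_neg : _root_.stdGaussian.map (fun x => -x) = _root_.stdGaussian := by
  unfold _root_.stdGaussian
  rw [gaussianReal_map_neg, neg_zero]

theorem measurePreserving_neg_stdGaussian :
    MeasurePreserving (fun x : ℝ => -x) _root_.stdGaussian _root_.stdGaussian :=
  ⟨measurable_neg, stdGaussian_map_neg⟩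

theorem memLp_id_stdGaussian : MemLp (fun x : ℝ => x) 2 _root_.stdGaussian :=
  memLp_id_gaussianReal' 2 (by simp)

/-- The density of `Y Z₁` with respect to the standard Gaussian measure. -/
def margDensity (ρ : ℝ) (f : ℝ → ℝ) (x : ℝ) : ℝ := f (ρ * x) + (1 - f (ρ * -x))

/-- The law of `(Y Z₁, Z₂)`. -/
def marginLaw (ρ : ℝ) (f : ℝ → ℝ) : Measure (ℝ × ℝ) :=
  (_root_.stdGaussian.prod _root_.stdGaussian).withDensity fun p => ENNReal.ofReal (margDensity ρ f p.1)

section Law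

variable {ρ : ℝ} {f : ℝ → ℝ}

theorem margDensity_nonneg (hf : ∀ t, f t ∈ Set.Icc (0 : ℝ) 1) (x : ℝ) :
    0 ≤ margDensity ρ f x := by
  have h1 := (hf (ρ * x)).1
  have h2 := (hf (ρ * -x)).2
  unfold margDensity
  linarith

theorem margDensity_le_two (hf : ∀ t, f t ∈ Set.Icc (0 : ℝ) 1) (x : ℝ) :
    margDensity ρ f x ≤ 2 := by
  have h1 := (hf (ρ * x)).2
  have h2 := (hf (ρ * -x)).1
  unfold margDensity
  linarith

theorem continuous_margDensity (hfc : Continuous f) : Continuous (margDensity ρ f) := by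
  unfold margDensity
  fun_prop

theorem margDensity_zero : margDensity ρ f 0 = 1 := by simp [margDensity]

theorem marginLaw_le (hf : ∀ t, f t ∈ Set.Icc (0 : ℝ) 1) :
    marginLaw ρ f ≤ (2 : ENNReal) • _root_.stdGaussian.prod _root_.stdGaussian := by
  rw [← withDensity_const]
  refine withDensity_mono (Eventually.of_forall fun p => ?_)
  have := ENNReal.ofReal_le_ofReal (margDensity_le_two (ρ := ρ) hf p.1)
  simpa using this

theorem memLp_marginLaw (hf : ∀ t, f t ∈ Set.Icc (0 : ℝ) 1) {φ : ℝ × ℝ → ℝ}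
    (hφ : MemLp φ 2 (_root_.stdGaussian.prod _root_.stdGaussian)) : MemLp φ 2 (marginLaw ρ f) :=
  hφ.of_measure_le_smul (c := 2) (by simp) (marginLaw_le hf)

theorem memLp_fst_gauss : MemLp (fun p : ℝ × ℝ => p.1) 2 (_root_.stdGaussian.prod _root_.stdGaussian) :=
  memLp_id_stdGaussian.comp_measurePreserving measurePreserving_fst

theorem memLp_snd_gauss : MemLp (fun p : ℝ × ℝ => p.2) 2 (_root_.stdGaussian.prod _root_.stdGaussian) :=
  memLp_id_stdGaussian.comp_measurePreserving measurePreserving_snd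

theorem measurable_ofReal_margDensity (hfc : Continuous f) :
    Measurable fun p : ℝ × ℝ => ENNReal.ofReal (margDensity ρ f p.1) :=
  ((continuous_margDensity hfc).measurable.comp measurable_fst).ennreal_ofReal

theorem Egen_eq_integral_marginLaw (hfc : Continuous f) (hf : ∀ t, f t ∈ Set.Icc (0 : ℝ) 1)
    {φ : ℝ × ℝ → ℝ} (hφ : Integrable φ (_root_.stdGaussian.prod _root_.stdGaussian)) :
    Egen ρ f (fun y z₁ z₂ => φ (y * z₁, z₂)) = ∫ p, φ p ∂marginLaw ρ f := by
  have hmp : MeasurePreserving (fun p : ℝ × ℝ => (-p.1, p.2))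
      (_root_.stdGaussian.prod _root_.stdGaussian) (_root_.stdGaussian.prod _root_.stdGaussian) :=
    measurePreserving_neg_stdGaussian.prod (MeasurePreserving.id _)
  have hme : MeasurableEmbedding fun p : ℝ × ℝ => (-p.1, p.2) :=
    ((MeasurableEquiv.neg ℝ).prodCongr (MeasurableEquiv.refl ℝ)).measurableEmbedding
  have hbd : ∀ (u : ℝ → ℝ), Continuous u → (∀ x, u x ∈ Set.Icc (0 : ℝ) 1) →
      ∀ {χ : ℝ × ℝ → ℝ}, Integrable χ (_root_.stdGaussian.prod _root_.stdGaussian) →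
      Integrable (fun p : ℝ × ℝ => u p.1 * χ p) (_root_.stdGaussian.prod _root_.stdGaussian) := by
    intro u hu hu1 χ hχ
    refine hχ.bdd_mul (c := 1) (hu.comp continuous_fst).aestronglyMeasurable
      (Eventually.of_forall fun p => ?_)
    rw [Real.norm_eq_abs, abs_le]
    constructor <;> linarith [(hu1 p.1).1, (hu1 p.1).2]
  have hφn : Integrable (fun p : ℝ × ℝ => φ (-p.1, p.2)) (_root_.stdGaussian.prod _root_.stdGaussian) :=
    hmp.integrable_comp_of_integrable hφ
  have i1 := hbd (fun x => f (ρ * x)) (by fun_prop) (fun x => hf _) hφ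
  have i2 := hbd (fun x => 1 - f (ρ * x)) (by fun_prop)
    (fun x => ⟨by linarith [(hf (ρ * x)).2], by linarith [(hf (ρ * x)).1]⟩) hφn
  have i3 := hbd (fun x => 1 - f (ρ * -x)) (by fun_prop)
    (fun x => ⟨by linarith [(hf (ρ * -x)).2], by linarith [(hf (ρ * -x)).1]⟩) hφ
  have e1 : Egen ρ f (fun y z₁ z₂ => φ (y * z₁, z₂)) =
      ∫ p, (f (ρ * p.1) * φ p + (1 - f (ρ * p.1)) * φ (-p.1, p.2))
        ∂_root_.stdGaussian.prod _root_.stdGaussian := by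
    rw [integral_prod (fun p : ℝ × ℝ => f (ρ * p.1) * φ p + (1 - f (ρ * p.1)) * φ (-p.1, p.2))
      (i1.add i2)]
    simp [Egen]
  have e2 : ∫ p : ℝ × ℝ, (1 - f (ρ * p.1)) * φ (-p.1, p.2) ∂_root_.stdGaussian.prod _root_.stdGaussian =
      ∫ p : ℝ × ℝ, (1 - f (ρ * -p.1)) * φ p ∂_root_.stdGaussian.prod _root_.stdGaussian := by
    rw [← hmp.integral_comp hme fun p : ℝ × ℝ => (1 - f (ρ * -p.1)) * φ p]
    simp
  rw [e1, integral_add i1 i2, e2, ← integral_add i1 i3, marginLaw,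
    integral_withDensity_eq_integral_toReal_smul (measurable_ofReal_margDensity hfc)
      (Eventually.of_forall fun _ => ENNReal.ofReal_lt_top)]
  refine integral_congr_ae (Eventually.of_forall fun p => ?_)
  simp only [ENNReal.toReal_ofReal (margDensity_nonneg hf p.1), smul_eq_mul]
  unfold margDensity
  ring

theorem eq_zero_of_ae_marginLaw (hfc : Continuous f) {u : ℝ × ℝ → ℝ} (hu : Continuous u)
    (h : ∀ᵐ p ∂marginLaw ρ f, u p = 0) {x : ℝ} (hx : 0 < margDensity ρ f x) (z : ℝ) :
    u (x, z) = 0 := by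
  rw [marginLaw, ae_withDensity_iff (measurable_ofReal_margDensity hfc)] at h
  by_contra hne
  have ho : IsOpen {p : ℝ × ℝ | 0 < margDensity ρ f p.1 ∧ u p ≠ 0} :=
    (isOpen_lt continuous_const ((continuous_margDensity hfc).comp continuous_fst)).inter
      (isOpen_ne_fun hu continuous_const)
  refine ho.measure_ne_zero (_root_.stdGaussian.prod _root_.stdGaussian) ⟨(x, z), hx, hne⟩ ?_
  refine measure_mono_null ?_ h
  rintro p ⟨hp1, hp2⟩ hp
  exact hp2 (hp (by simpa using hp1))

theorem exists_margDensity_pos (hfc : Continuous f) :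
    ∃ δ > 0, 0 < margDensity ρ f δ ∧ 0 < margDensity ρ f (-δ) := by
  have h0 : ∀ᶠ x in 𝓝 (0 : ℝ), 0 < margDensity ρ f x :=
    (continuous_margDensity hfc).continuousAt.eventually_const_lt (by simp [margDensity_zero])
  obtain ⟨ε, hε, h⟩ := Metric.eventually_nhds_iff.1 h0
  refine ⟨ε / 2, by positivity, h ?_, h ?_⟩ <;>
  · simp only [Real.dist_eq, sub_zero, abs_neg]
    rw [abs_of_pos (by positivity)]
    linarith

theorem measurePreserving_marginLaw (hfc : Continuous f) :
    MeasurePreserving (fun p : ℝ × ℝ => (p.1, -p.2)) (marginLaw ρ f) (marginLaw ρ f) := by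
  have hmp : MeasurePreserving (fun p : ℝ × ℝ => (p.1, -p.2))
      (_root_.stdGaussian.prod _root_.stdGaussian) (_root_.stdGaussian.prod _root_.stdGaussian) :=
    (MeasurePreserving.id _).prod measurePreserving_neg_stdGaussian
  have hm := measurable_ofReal_margDensity (ρ := ρ) hfc
  refine ⟨hmp.measurable, ?_⟩
  ext s hs
  rw [Measure.map_apply hmp.measurable hs, marginLaw, withDensity_apply _ hs,
    withDensity_apply _ (hmp.measurable hs)]
  exact hmp.setLIntegral_comp_preimage hs hm

end Law

section Slack

variable {ρ : ℝ} {f : ℝ → ℝ}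

/-- The constant `1` as an element of `L²` of the law of `(Y Z₁, Z₂)`. -/
def oneL2 (hf : ∀ t, f t ∈ Set.Icc (0 : ℝ) 1) : Lp ℝ 2 (marginLaw ρ f) :=
  (memLp_marginLaw hf (memLp_const 1)).toLp fun _ => 1

/-- `Y Z₁` as an element of `L²`. -/
def fstL2 (hf : ∀ t, f t ∈ Set.Icc (0 : ℝ) 1) : Lp ℝ 2 (marginLaw ρ f) :=
  (memLp_marginLaw hf memLp_fst_gauss).toLp fun p => p.1

/-- `Z₂` as an element of `L²`. -/
def sndL2 (hf : ∀ t, f t ∈ Set.Icc (0 : ℝ) 1) : Lp ℝ 2 (marginLaw ρ f) :=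
  (memLp_marginLaw hf memLp_snd_gauss).toLp fun p => p.2

/-- `κ - c₁ Y Z₁ - c₂ Z₂` as an element of `L²`. -/
def slack (ρ : ℝ) (hf : ∀ t, f t ∈ Set.Icc (0 : ℝ) 1) (κ c₁ c₂ : ℝ) : Lp ℝ 2 (marginLaw ρ f) :=
  κ • oneL2 hf - c₁ • fstL2 hf - c₂ • sndL2 hf

theorem coeFn_slack (hf : ∀ t, f t ∈ Set.Icc (0 : ℝ) 1) (κ c₁ c₂ : ℝ) :
    slack ρ hf κ c₁ c₂ =ᵐ[marginLaw ρ f] fun p => κ - c₁ * p.1 - c₂ * p.2 := by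
  unfold slack oneL2 fstL2 sndL2
  have h1 := memLp_marginLaw (ρ := ρ) hf (memLp_const (1 : ℝ))
  have h2 := memLp_marginLaw (ρ := ρ) hf memLp_fst_gauss
  have h3 := memLp_marginLaw (ρ := ρ) hf memLp_snd_gauss
  filter_upwards [Lp.coeFn_sub (κ • h1.toLp _ - c₁ • h2.toLp _) (c₂ • h3.toLp _),
    Lp.coeFn_sub (κ • h1.toLp _) (c₁ • h2.toLp _), Lp.coeFn_smul κ (h1.toLp _),
    Lp.coeFn_smul c₁ (h2.toLp _), Lp.coeFn_smul c₂ (h3.toLp _), h1.coeFn_toLp, h2.coeFn_toLp,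
    h3.coeFn_toLp] with p e1 e2 e3 e4 e5 e6 e7 e8
  rw [e1, Pi.sub_apply, e2, Pi.sub_apply, e3, e4, e5]
  simp only [Pi.smul_apply, e6, e7, e8, smul_eq_mul, mul_one]

theorem coeFn_slack_posPart (hf : ∀ t, f t ∈ Set.Icc (0 : ℝ) 1) (κ c₁ c₂ : ℝ) :
    ⇑((slack ρ hf κ c₁ c₂)⁺) =ᵐ[marginLaw ρ f] fun p => max (κ - c₁ * p.1 - c₂ * p.2) 0 := by
  rw [posPart_def]
  filter_upwards [Lp.coeFn_sup (slack ρ hf κ c₁ c₂) 0, coeFn_slack hf κ c₁ c₂,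
    Lp.coeFn_zero ℝ 2 (marginLaw ρ f)] with p h1 h2 h3
  rw [h1, Pi.sup_apply, h2, h3]
  rfl

theorem memLp_hinge (κ c₁ c₂ : ℝ) :
    MemLp (fun p : ℝ × ℝ => max (κ - c₁ * p.1 - c₂ * p.2) 0) 2
      (_root_.stdGaussian.prod _root_.stdGaussian) := by
  have h : MemLp (fun p : ℝ × ℝ => κ - c₁ * p.1 - c₂ * p.2) 2
      (_root_.stdGaussian.prod _root_.stdGaussian) :=
    ((memLp_const κ).sub (memLp_fst_gauss.const_mul c₁)).sub (memLp_snd_gauss.const_mul c₂)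
  exact h.pos_part

theorem Fk_eq_norm (hfc : Continuous f) (hf : ∀ t, f t ∈ Set.Icc (0 : ℝ) 1) (κ c₁ c₂ : ℝ) :
    Fk ρ f κ c₁ c₂ = ‖(slack ρ hf κ c₁ c₂)⁺‖ := by
  have h := Egen_eq_integral_marginLaw (ρ := ρ) hfc hf (memLp_hinge κ c₁ c₂).integrable_sq
  rw [← Real.sqrt_sq (norm_nonneg (slack ρ hf κ c₁ c₂)⁺), ← real_inner_self_eq_norm_sq,
    L2.inner_def, Fk]
  congr 1
  simp only [← mul_assoc] at h
  rw [h]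
  refine integral_congr_ae ?_
  filter_upwards [coeFn_slack_posPart (ρ := ρ) hf κ c₁ c₂] with p hp
  rw [hp]
  simp [sq]

theorem Fk_nonneg (κ c₁ c₂ : ℝ) : 0 ≤ Fk ρ f κ c₁ c₂ := Real.sqrt_nonneg _

theorem d1F_eq_inner (hfc : Continuous f) (hf : ∀ t, f t ∈ Set.Icc (0 : ℝ) 1) (κ c₁ c₂ : ℝ) :
    d1F ρ f κ c₁ c₂ = -inner ℝ (slack ρ hf κ c₁ c₂)⁺ (fstL2 hf) / Fk ρ f κ c₁ c₂ := by
  have h := Egen_eq_integral_marginLaw (ρ := ρ) hfc hf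
    (memLp_fst_gauss.integrable_mul (memLp_hinge κ c₁ c₂))
  simp only [← mul_assoc, Pi.mul_apply] at h
  rw [d1F, h, L2.inner_def]
  congr 2
  refine integral_congr_ae ?_
  filter_upwards [coeFn_slack_posPart (ρ := ρ) hf κ c₁ c₂,
    (memLp_marginLaw (ρ := ρ) hf memLp_fst_gauss).coeFn_toLp] with p hp hp2
  rw [hp, fstL2, hp2]
  simp

theorem d2F_eq_inner (hfc : Continuous f) (hf : ∀ t, f t ∈ Set.Icc (0 : ℝ) 1) (κ c₁ c₂ : ℝ) :
    d2F ρ f κ c₁ c₂ = -inner ℝ (slack ρ hf κ c₁ c₂)⁺ (sndL2 hf) / Fk ρ f κ c₁ c₂ := by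
  have h := Egen_eq_integral_marginLaw (ρ := ρ) hfc hf
    (memLp_snd_gauss.integrable_mul (memLp_hinge κ c₁ c₂))
  simp only [← mul_assoc, Pi.mul_apply] at h
  rw [d2F, h, L2.inner_def]
  congr 2
  refine integral_congr_ae ?_
  filter_upwards [coeFn_slack_posPart (ρ := ρ) hf κ c₁ c₂,
    (memLp_marginLaw (ρ := ρ) hf memLp_snd_gauss).coeFn_toLp] with p hp hp2
  rw [hp, sndL2, hp2]
  simp

theorem slack_combo (hf : ∀ t, f t ∈ Set.Icc (0 : ℝ) 1) (κ κ' c₁ c₂ c₁' c₂' a b : ℝ) :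
    slack ρ hf (a * κ + b * κ') (a * c₁ + b * c₁') (a * c₂ + b * c₂') =
      a • slack ρ hf κ c₁ c₂ + b • slack ρ hf κ' c₁' c₂' := by
  unfold slack
  module

theorem Fk_eq_of_eq_combo (hfc : Continuous f) (hf : ∀ t, f t ∈ Set.Icc (0 : ℝ) 1)
    (κ κ' c₁ c₂ c₁' c₂' : ℝ) {a b : ℝ} (ha : 0 ≤ a) (hb : 0 ≤ b) :
    Fk ρ f (a * κ + b * κ') (a * c₁ + b * c₁') (a * c₂ + b * c₂') ≤
      a * Fk ρ f κ c₁ c₂ + b * Fk ρ f κ' c₁' c₂' := by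
  simp only [Fk_eq_norm hfc hf]
  rw [slack_combo, ← L2_norm_posPart_smul _ ha, ← L2_norm_posPart_smul _ hb]
  exact L2_norm_posPart_add_le _ _

theorem continuous_Fk (hfc : Continuous f) (hf : ∀ t, f t ∈ Set.Icc (0 : ℝ) 1) (κ : ℝ) :
    Continuous fun c : ℝ × ℝ => Fk ρ f κ c.1 c.2 := by
  simp only [Fk_eq_norm hfc hf]
  refine L2_continuous_norm_posPart.comp ?_
  unfold slack
  fun_prop

theorem Fk_neg_right (hfc : Continuous f) (hf : ∀ t, f t ∈ Set.Icc (0 : ℝ) 1) (κ c₁ c₂ : ℝ) :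
    Fk ρ f κ c₁ (-c₂) = Fk ρ f κ c₁ c₂ := by
  have h := Egen_eq_integral_marginLaw (ρ := ρ) hfc hf (memLp_hinge κ c₁ c₂).integrable_sq
  have h' := Egen_eq_integral_marginLaw (ρ := ρ) hfc hf (memLp_hinge κ c₁ (-c₂)).integrable_sq
  simp only [← mul_assoc] at h h'
  have hme : MeasurableEmbedding fun p : ℝ × ℝ => (p.1, -p.2) :=
    ((MeasurableEquiv.refl ℝ).prodCongr (MeasurableEquiv.neg ℝ)).measurableEmbedding
  rw [Fk, Fk, h, h', ← (measurePreserving_marginLaw hfc).integral_comp hme]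
  simp

theorem Fk_mono_right (hfc : Continuous f) (hf : ∀ t, f t ∈ Set.Icc (0 : ℝ) 1) (κ c₁ : ℝ)
    {c₂ c₂' : ℝ} (h0 : 0 ≤ c₂) (h : c₂ ≤ c₂') : Fk ρ f κ c₁ c₂ ≤ Fk ρ f κ c₁ c₂' := by
  rcases (h0.trans h).eq_or_lt with h1 | h1
  · rw [show c₂ = c₂' by linarith]
  have ha : 0 ≤ (c₂' + c₂) / (2 * c₂') := by positivity
  have hb : 0 ≤ (c₂' - c₂) / (2 * c₂') := div_nonneg (by linarith) (by positivity)
  have := Fk_eq_of_eq_combo (ρ := ρ) hfc hf κ κ c₁ c₂' c₁ (-c₂') ha hb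
  rw [Fk_neg_right hfc hf, ← add_mul, ← add_mul, ← add_mul] at this
  have e : (c₂' + c₂) / (2 * c₂') + (c₂' - c₂) / (2 * c₂') = 1 := by field_simp; ring
  have e2 : (c₂' + c₂) / (2 * c₂') * c₂' + (c₂' - c₂) / (2 * c₂') * -c₂' = c₂ := by
    field_simp; ring
  rw [e, e2] at this
  simpa using this

theorem Fk_zero_smul (hfc : Continuous f) (hf : ∀ t, f t ∈ Set.Icc (0 : ℝ) 1) (c₁ c₂ : ℝ) {t : ℝ}
    (ht : 0 ≤ t) : Fk ρ f 0 (t * c₁) (t * c₂) = t * Fk ρ f 0 c₁ c₂ := by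
  simp only [Fk_eq_norm hfc hf]
  rw [← L2_norm_posPart_smul _ ht]
  congr 2
  unfold slack
  module

theorem Fk_smul_le (hfc : Continuous f) (hf : ∀ t, f t ∈ Set.Icc (0 : ℝ) 1) (κ c₁ c₂ : ℝ) {t : ℝ}
    (ht : 0 ≤ t) : Fk ρ f κ (t * c₁) (t * c₂) ≤ Fk ρ f κ 0 0 + t * Fk ρ f 0 c₁ c₂ := by
  have := Fk_eq_of_eq_combo (ρ := ρ) hfc hf κ 0 0 0 c₁ c₂ zero_le_one ht
  simpa using this

theorem Fk_pos (hfc : Continuous f) (hf : ∀ t, f t ∈ Set.Icc (0 : ℝ) 1) {κ c₁ c₂ : ℝ}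
    (hκ : 0 ≤ κ) (h : ¬(κ = 0 ∧ c₁ = 0 ∧ c₂ = 0)) : 0 < Fk ρ f κ c₁ c₂ := by
  refine (Fk_nonneg _ _ _).lt_of_ne' fun h0 => h ?_
  rw [Fk_eq_norm hfc hf, norm_eq_zero] at h0
  have hae : ∀ᵐ p ∂marginLaw ρ f, max (κ - c₁ * p.1 - c₂ * p.2) 0 = 0 := by
    filter_upwards [coeFn_slack_posPart (ρ := ρ) hf κ c₁ c₂,
      Lp.coeFn_zero ℝ 2 (marginLaw ρ f)] with p h1 h2
    rw [← h1, h0, h2]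
    rfl
  obtain ⟨δ, hδ, hp, hn⟩ := exists_margDensity_pos (ρ := ρ) hfc
  have hu : Continuous fun p : ℝ × ℝ => max (κ - c₁ * p.1 - c₂ * p.2) 0 := by fun_prop
  have key : ∀ x, 0 < margDensity ρ f x → ∀ z, κ - c₁ * x - c₂ * z ≤ 0 := fun x hx z => by
    simpa using eq_zero_of_ae_marginLaw hfc hu hae hx z
  have k1 := key δ hp 0
  have k2 := key (-δ) hn 0
  have k3 := key δ hp 1
  have k4 := key δ hp (-1)
  have k5 := key (-δ) hn 1
  have k6 := key (-δ) hn (-1)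
  have hκ0 : κ = 0 := by linarith
  have hc : c₁ * δ = 0 := by linarith
  have hc1 : c₁ = 0 := by simpa [hδ.ne'] using hc
  exact ⟨hκ0, hc1, by subst hκ0 hc1; linarith⟩

theorem Fk_mul_sub_eq (hfc : Continuous f) (hf : ∀ t, f t ∈ Set.Icc (0 : ℝ) 1)
    {κ c₁ c₂ : ℝ} (hpos : 0 < Fk ρ f κ c₁ c₂) (c₁' c₂' : ℝ) :
    inner ℝ (slack ρ hf κ c₁ c₂)⁺ (slack ρ hf κ c₁' c₂') = Fk ρ f κ c₁ c₂ *
      (Fk ρ f κ c₁ c₂ + d1F ρ f κ c₁ c₂ * (c₁' - c₁) + d2F ρ f κ c₁ c₂ * (c₂' - c₂)) := by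
  have e : slack ρ hf κ c₁' c₂' = slack ρ hf κ c₁ c₂ - (c₁' - c₁) • fstL2 hf
      - (c₂' - c₂) • sndL2 hf := by
    unfold slack
    module
  rw [e, inner_sub_right, inner_sub_right, L2_inner_posPart_self, ← Fk_eq_norm hfc hf,
    inner_smul_right, inner_smul_right, d1F_eq_inner hfc hf, d2F_eq_inner hfc hf]
  field_simp
  ring

theorem Fk_gradient_le (hfc : Continuous f) (hf : ∀ t, f t ∈ Set.Icc (0 : ℝ) 1)
    {κ c₁ c₂ : ℝ} (hpos : 0 < Fk ρ f κ c₁ c₂) (c₁' c₂' : ℝ) :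
    Fk ρ f κ c₁ c₂ + d1F ρ f κ c₁ c₂ * (c₁' - c₁) + d2F ρ f κ c₁ c₂ * (c₂' - c₂) ≤
      Fk ρ f κ c₁' c₂' := by
  have h := L2_inner_le_norm_posPart (slack ρ hf κ c₁ c₂) (slack ρ hf κ c₁' c₂')
  rw [Fk_mul_sub_eq hfc hf hpos, ← Fk_eq_norm hfc hf, ← Fk_eq_norm hfc hf] at h
  exact le_of_mul_le_mul_left h hpos

theorem eq_smul_of_Fk_gradient_eq (hfc : Continuous f) (hf : ∀ t, f t ∈ Set.Icc (0 : ℝ) 1)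
    {κ c₁ c₂ : ℝ} (hpos : 0 < Fk ρ f κ c₁ c₂) {c₁' c₂' : ℝ} (h2 : 0 < c₂) (h2' : 0 < c₂')
    (heq : Fk ρ f κ c₁' c₂' = Fk ρ f κ c₁ c₂ + d1F ρ f κ c₁ c₂ * (c₁' - c₁) +
      d2F ρ f κ c₁ c₂ * (c₂' - c₂)) :
    ∃ t, 0 ≤ t ∧ κ = t * κ ∧ c₁' = t * c₁ ∧ c₂' = t * c₂ := by
  set a := slack ρ hf κ c₁ c₂ with ha
  set b := slack ρ hf κ c₁' c₂' with hb
  have hab : inner ℝ a⁺ b⁺ = ‖a⁺‖ * ‖b⁺‖ := by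
    refine le_antisymm (real_inner_le_norm _ _) ?_
    have h1 := L2_inner_le_inner_posPart a b
    rw [Fk_mul_sub_eq hfc hf hpos, ← heq] at h1
    rwa [← Fk_eq_norm hfc hf, ← Fk_eq_norm hfc hf]
  rw [inner_eq_norm_mul_iff_real, ← Fk_eq_norm hfc hf, ← Fk_eq_norm hfc hf] at hab
  have hab2 : b⁺ = (Fk ρ f κ c₁' c₂' / Fk ρ f κ c₁ c₂) • a⁺ := by
    rw [div_eq_inv_mul, ← smul_smul, hab, smul_smul, inv_mul_cancel₀ hpos.ne', one_smul]
  have ht : 0 ≤ Fk ρ f κ c₁' c₂' / Fk ρ f κ c₁ c₂ := div_nonneg (Fk_nonneg _ _ _) hpos.le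
  generalize Fk ρ f κ c₁' c₂' / Fk ρ f κ c₁ c₂ = t at hab2 ht
  have hae : ∀ᵐ p ∂marginLaw ρ f, max (κ - c₁' * p.1 - c₂' * p.2) 0 -
      t * max (κ - c₁ * p.1 - c₂ * p.2) 0 = 0 := by
    filter_upwards [coeFn_slack_posPart (ρ := ρ) hf κ c₁ c₂,
      coeFn_slack_posPart (ρ := ρ) hf κ c₁' c₂', Lp.coeFn_smul t a⁺] with p h3 h4 h5
    rw [← h3, ← h4, ← hb, hab2, h5, ← ha]
    simp
  obtain ⟨δ, hδ, hp, -⟩ := exists_margDensity_pos (ρ := ρ) hfc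
  have hu : Continuous fun p : ℝ × ℝ => max (κ - c₁' * p.1 - c₂' * p.2) 0 -
      t * max (κ - c₁ * p.1 - c₂ * p.2) 0 := by fun_prop
  have key : ∀ x, 0 < margDensity ρ f x → ∃ M, ∀ z, z ≤ M →
      κ - c₁' * x - c₂' * z = t * (κ - c₁ * x - c₂ * z) := by
    intro x hx
    refine ⟨min ((κ - c₁ * x) / c₂) ((κ - c₁' * x) / c₂'), fun z hz => ?_⟩
    rw [le_min_iff, le_div_iff₀ h2, le_div_iff₀ h2'] at hz
    have := eq_zero_of_ae_marginLaw hfc hu hae hx z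
    simp only at this
    rw [max_eq_left (by linarith), max_eq_left (by linarith)] at this
    linarith
  obtain ⟨M0, hM0⟩ := key 0 (by simp [margDensity_zero])
  obtain ⟨M1, hM1⟩ := key δ hp
  have q1 := hM0 M0 le_rfl
  have q2 := hM0 (M0 - 1) (by linarith)
  have q3 := hM1 M1 le_rfl
  have e2 : c₂' = t * c₂ := by linarith
  have eκ : κ = t * κ := by
    have : t * c₂ * M0 = c₂' * M0 := by rw [e2]
    linarith
  refine ⟨t, ht, eκ, ?_, e2⟩
  have h3 : t * c₂ * M1 = c₂' * M1 := by rw [e2]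
  have : (c₁' - t * c₁) * δ = 0 := by linarith
  have := (mul_eq_zero.1 this).resolve_right hδ.ne'
  linarith

theorem Fk_hasDerivAt_comp (hfc : Continuous f) (hf : ∀ t, f t ∈ Set.Icc (0 : ℝ) 1) (κ : ℝ)
    {u v : ℝ → ℝ} {u' v' : ℝ} {S : Set ℝ} {x : ℝ} (hu : HasDerivWithinAt u u' S x)
    (hv : HasDerivWithinAt v v' S x) (hpos : 0 < Fk ρ f κ (u x) (v x)) :
    HasDerivWithinAt (fun t => Fk ρ f κ (u t) (v t))
      (d1F ρ f κ (u x) (v x) * u' + d2F ρ f κ (u x) (v x) * v') S x := by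
  have h1 : HasDerivWithinAt (fun t => slack ρ hf κ (u t) (v t))
      (0 - u' • fstL2 hf - v' • sndL2 hf) S x :=
    ((hasDerivWithinAt_const x S _).sub (hu.smul_const _)).sub (hv.smul_const _)
  have hpos' := hpos
  rw [Fk_eq_norm hfc hf] at hpos'
  have h2 := (L2_hasFDerivAt_norm_posPart hpos').comp_hasDerivWithinAt x h1
  rw [d1F_eq_inner hfc hf, d2F_eq_inner hfc hf]
  simp only [Fk_eq_norm hfc hf]
  refine h2.congr_deriv ?_
  simp only [smul_apply, innerSL_apply_apply, inner_sub_right, inner_smul_right,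
    inner_zero_right, smul_eq_mul]
  field_simp
  ring

theorem d2F_zero_right (hfc : Continuous f) (hf : ∀ t, f t ∈ Set.Icc (0 : ℝ) 1) (κ c₁ : ℝ) :
    d2F ρ f κ c₁ 0 = 0 := by
  have hme : MeasurableEmbedding fun p : ℝ × ℝ => (p.1, -p.2) :=
    ((MeasurableEquiv.refl ℝ).prodCongr (MeasurableEquiv.neg ℝ)).measurableEmbedding
  have h := Egen_eq_integral_marginLaw (ρ := ρ) hfc hf
    (memLp_snd_gauss.integrable_mul (memLp_hinge κ c₁ 0))
  simp only [← mul_assoc, Pi.mul_apply] at h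
  rw [d2F, h]
  have := (measurePreserving_marginLaw (ρ := ρ) hfc).integral_comp hme
    fun p => p.2 * max (κ - c₁ * p.1 - 0 * p.2) 0
  simp only [neg_mul, integral_neg, zero_mul, sub_zero, neg_zero, mul_neg] at this ⊢
  have h0 : ∫ p : ℝ × ℝ, p.2 * max (κ - c₁ * p.1) 0 ∂marginLaw ρ f = 0 := by linarith
  rw [h0]
  simp

theorem d2F_pos (hfc : Continuous f) (hf : ∀ t, f t ∈ Set.Icc (0 : ℝ) 1) {κ : ℝ} (hκ : 0 ≤ κ)
    (c₁ : ℝ) {c₂ : ℝ} (h2 : 0 < c₂) : 0 < d2F ρ f κ c₁ c₂ := by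
  have hpos : 0 < Fk ρ f κ c₁ c₂ := Fk_pos hfc hf hκ fun h => h2.ne' h.2.2
  by_contra! hneg
  have hle : Fk ρ f κ c₁ c₂ ≤ Fk ρ f κ c₁ 0 := by
    have := Fk_gradient_le hfc hf hpos c₁ 0
    nlinarith
  have hge : Fk ρ f κ c₁ c₂ + d2F ρ f κ c₁ c₂ * (-c₂ - c₂) ≤ Fk ρ f κ c₁ c₂ := by
    have := Fk_gradient_le hfc hf hpos c₁ (-c₂)
    rw [Fk_neg_right hfc hf] at this
    linarith
  have h0 : d2F ρ f κ c₁ c₂ = 0 := by nlinarith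
  have heq : ∀ c, 0 < c → c ≤ c₂ → Fk ρ f κ c₁ c = Fk ρ f κ c₁ c₂ + d1F ρ f κ c₁ c₂ * (c₁ - c₁) +
      d2F ρ f κ c₁ c₂ * (c - c₂) := by
    intro c hc hcc
    rw [h0]
    have h3 := Fk_mono_right (ρ := ρ) hfc hf κ c₁ hc.le hcc
    have h4 := Fk_mono_right (ρ := ρ) hfc hf κ c₁ le_rfl hc.le
    linarith
  obtain ⟨t, -, hk, h1, h3⟩ := eq_smul_of_Fk_gradient_eq hfc hf hpos h2 (half_pos h2)
    (heq (c₂ / 2) (half_pos h2) (by linarith))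
  have ht : t = 1 / 2 := by field_simp; nlinarith
  subst ht
  have hk0 : κ = 0 := by linarith
  have hc0 : c₁ = 0 := by linarith
  subst hk0 hc0
  have e := Fk_zero_smul (ρ := ρ) hfc hf 0 c₂ (t := 1 / 2) (by norm_num)
  have e2 := heq (c₂ / 2) (half_pos h2) (by linarith)
  rw [h0] at e2
  rw [mul_zero, ← h3] at e
  linarith

theorem exists_Fk_ge (hfc : Continuous f) (hf : ∀ t, f t ∈ Set.Icc (0 : ℝ) 1) {κ : ℝ}
    (hκ : 0 ≤ κ) : ∃ α > 0, ∃ β : ℝ, ∀ c₁ c₂, α * c₂ - β * |c₁| ≤ Fk ρ f κ c₁ c₂ := by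
  have hpos : 0 < Fk ρ f κ 0 1 := Fk_pos hfc hf hκ (by simp)
  have h0 : 0 < Fk ρ f 0 0 1 := Fk_pos hfc hf le_rfl (by simp)
  have h2 := d2F_pos (ρ := ρ) hfc hf le_rfl 0 one_pos
  refine ⟨d2F ρ f 0 0 1, h2, |d1F ρ f 0 0 1|, fun c₁ c₂ => ?_⟩
  have h3 := Fk_gradient_le hfc hf h0 0 0
  have h3' := Fk_gradient_le hfc hf h0 (2 * 0) (2 * 1)
  rw [Fk_zero_smul hfc hf _ _ (by norm_num)] at h3'
  have h5 : Fk ρ f 0 0 0 = 0 := by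
    have := Fk_zero_smul (ρ := ρ) hfc hf 0 0 (t := 0) le_rfl
    simpa using this
  have h4 := Fk_gradient_le hfc hf h0 c₁ c₂
  have h6 := Fk_eq_of_eq_combo (ρ := ρ) hfc hf κ 0 c₁ c₂ 0 0 zero_le_one zero_le_one
  have h7 := neg_abs_le (d1F ρ f 0 0 1 * c₁)
  rw [abs_mul] at h7
  have h8 : Fk ρ f 0 c₁ c₂ ≤ Fk ρ f κ c₁ c₂ := by
    rw [Fk_eq_norm hfc hf, Fk_eq_norm hfc hf]
    have e : slack ρ hf 0 c₁ c₂ = slack ρ hf κ c₁ c₂ + κ • (-oneL2 hf) := by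
      unfold slack
      module
    rw [e]
    refine (L2_norm_posPart_add_le _ _).trans ?_
    rw [L2_norm_posPart_smul _ hκ]
    have : (-oneL2 hf : Lp ℝ 2 (marginLaw ρ f))⁺ = 0 := by
      rw [posPart_eq_zero, neg_nonpos, ← Lp.coeFn_nonneg]
      filter_upwards [(memLp_marginLaw (ρ := ρ) hf (memLp_const (1 : ℝ))).coeFn_toLp] with p hp
      rw [oneL2, hp]
      simp
    simp [this]
  simp only [sub_zero] at h4
  linarith

end Slack

section Lattice

variable {Ω : Type*} [MeasurableSpace Ω] {Q : Measure Ω}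

/-- The weighted `L¹` norm `∫ r |h|` on `L²`. -/
def wL1 (r h : Lp ℝ 2 Q) : ℝ := inner ℝ r |h|

theorem L2_abs_smul (t : ℝ) (h : Lp ℝ 2 Q) : |t • h| = |t| • |h| := by
  refine Lp.ext ?_
  filter_upwards [Lp.coeFn_abs (t • h), Lp.coeFn_smul t h, Lp.coeFn_smul |t| |h|,
    Lp.coeFn_abs h] with x h1 h2 h3 h4
  simp [h1, h2, h3, h4, abs_mul]

theorem wL1_smul (r : Lp ℝ 2 Q) (t : ℝ) (h : Lp ℝ 2 Q) : wL1 r (t • h) = |t| * wL1 r h := by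
  rw [wL1, L2_abs_smul, inner_smul_right, wL1]

theorem wL1_nonneg {r : Lp ℝ 2 Q} (hr : 0 ≤ r) (h : Lp ℝ 2 Q) : 0 ≤ wL1 r h :=
  L2_inner_nonneg hr (abs_nonneg h)

theorem wL1_add_le {r : Lp ℝ 2 Q} (hr : 0 ≤ r) (h h' : Lp ℝ 2 Q) :
    wL1 r (h + h') ≤ wL1 r h + wL1 r h' := by
  have := L2_inner_nonneg hr (sub_nonneg.2 (abs_add_le h h'))
  rw [inner_sub_right, inner_add_right] at this
  unfold wL1
  linarith

theorem wL1_of_nonneg (r : Lp ℝ 2 Q) {h : Lp ℝ 2 Q} (hh : 0 ≤ h) : wL1 r h = inner ℝ r h := by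
  rw [wL1, abs_of_nonneg hh]

theorem continuous_wL1 (r : Lp ℝ 2 Q) : Continuous (wL1 r) := by
  have h : Continuous fun h : Lp ℝ 2 Q => |h| := continuous_id.sup continuous_neg
  exact continuous_const.inner h

theorem L2_inner_le_of_abs_le {k b : Lp ℝ 2 Q} (hk : |k| ≤ b) (h : Lp ℝ 2 Q) :
    |inner ℝ k h| ≤ inner ℝ b |h| := by
  rw [← Lp.coeFn_le] at hk
  rw [L2.inner_def, L2.inner_def, ← Real.norm_eq_abs]
  refine norm_integral_le_of_norm_le (L2.integrable_inner b |h|) ?_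
  filter_upwards [hk, Lp.coeFn_abs k, Lp.coeFn_abs h] with x h1 h2 h3
  rw [h2] at h1
  simp only [h3, RCLike.inner_apply, conj_trivial, norm_mul, Real.norm_eq_abs]
  exact mul_le_mul_of_nonneg_left h1 (abs_nonneg _)

theorem abs_inner_le_wL1 {k r : Lp ℝ 2 Q} {s : ℝ} (hk : |k| ≤ s • r) (h : Lp ℝ 2 Q) :
    |inner ℝ k h| ≤ s * wL1 r h := by
  have := L2_inner_le_of_abs_le hk h
  rwa [real_inner_smul_left] at this

/-- A minimizer of a linear form over the unit ball of the weighted `L¹` norm certifies a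
pointwise bound on the linear form. -/
theorem abs_le_smul_of_isMin {k r h₀ : Lp ℝ 2 Q} (hr : 0 ≤ r)
    (hmin : ∀ h, wL1 r h ≤ 1 → inner ℝ k h₀ ≤ inner ℝ k h) :
    0 ≤ -inner ℝ k h₀ ∧ |k| ≤ (-inner ℝ k h₀) • r := by
  set s := -inner ℝ k h₀ with hs
  have hs0 : 0 ≤ s := by
    have := hmin 0 (by simp [wL1])
    rw [inner_zero_right] at this
    linarith
  have key : ∀ h, -inner ℝ k h ≤ s * wL1 r h := by
    intro h
    refine le_of_forall_pos_le_add fun ε hε => ?_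
    have hN := wL1_nonneg hr h
    set N := wL1 r h
    obtain ⟨η, hη, hη2⟩ : ∃ η > 0, s * η ≤ ε :=
      ⟨ε / (s + 1), by positivity, by
        rw [mul_div_assoc', div_le_iff₀ (by positivity)]
        nlinarith⟩
    have hpos : 0 < N + η := by positivity
    have h1 := hmin ((N + η)⁻¹ • h) (by
      rw [wL1_smul, abs_of_pos (by positivity), inv_mul_le_iff₀ hpos]
      change N ≤ _
      linarith)
    rw [inner_smul_right, inv_mul_eq_div, le_div_iff₀ hpos] at h1
    nlinarith
  have zero_of : ∀ a : Lp ℝ 2 Q, inner ℝ a a⁺ ≤ 0 → a ≤ 0 := by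
    intro a ha
    rw [real_inner_comm, L2_inner_posPart_self] at ha
    have h0 : a⁺ = 0 := by
      rw [← norm_eq_zero]
      have := sq_nonneg ‖a⁺‖
      exact pow_eq_zero_iff two_ne_zero |>.1 (le_antisymm ha this)
    exact posPart_eq_zero.1 h0
  refine ⟨hs0, abs_le'.2 ⟨?_, ?_⟩⟩
  · rw [← sub_nonpos]
    refine zero_of _ ?_
    set u := (k - s • r)⁺
    have h1 := key (-u)
    have h2 : wL1 r (-u) = inner ℝ r u := by
      rw [wL1, abs_neg, abs_of_nonneg (posPart_nonneg _)]
    rw [h2, inner_neg_right] at h1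
    rw [inner_sub_left, real_inner_smul_left]
    linarith
  · rw [← sub_nonpos]
    refine zero_of _ ?_
    set u := (-k - s • r)⁺
    have h1 := key u
    rw [wL1_of_nonneg r (posPart_nonneg _)] at h1
    rw [inner_sub_left, real_inner_smul_left, inner_neg_left]
    linarith

end Lattice

section Problem

variable {Ω : Type*} [MeasurableSpace Ω] {Q : Measure Ω}

/-- The component of `h` orthogonal to `w`. -/
def perp (w h : Lp ℝ 2 Q) : Lp ℝ 2 Q := h - (inner ℝ w h : ℝ) • w

theorem inner_perp {w : Lp ℝ 2 Q} (hw : ‖w‖ = 1) (h : Lp ℝ 2 Q) : inner ℝ w (perp w h) = 0 := by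
  rw [perp, inner_sub_right, inner_smul_right, real_inner_self_eq_norm_sq, hw]
  ring

theorem perp_add (w h h' : Lp ℝ 2 Q) : perp w (h + h') = perp w h + perp w h' := by
  simp only [perp, inner_add_right]
  module

theorem perp_smul (w h : Lp ℝ 2 Q) (t : ℝ) : perp w (t • h) = t • perp w h := by
  simp only [perp, inner_smul_right]
  module

theorem inner_perp_left {w : Lp ℝ 2 Q} (hw : ‖w‖ = 1) (h h' : Lp ℝ 2 Q) :
    inner ℝ (perp w h) h' = inner ℝ (perp w h) (perp w h') := by
  have h2 := inner_perp hw h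
  have h1 : h' = perp w h' + (inner ℝ w h' : ℝ) • w := by simp [perp]
  nth_rw 1 [h1]
  rw [inner_add_right, inner_smul_right, real_inner_comm, real_inner_comm w, h2]
  simp [real_inner_comm]

theorem norm_sq_eq_perp {w : Lp ℝ 2 Q} (hw : ‖w‖ = 1) (h : Lp ℝ 2 Q) :
    ‖h‖ ^ 2 = (inner ℝ w h : ℝ) ^ 2 + ‖perp w h‖ ^ 2 := by
  rw [perp, norm_sub_sq_real, inner_smul_right, norm_smul, hw, real_inner_comm, mul_one,
    Real.norm_eq_abs, sq_abs]
  ring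

theorem continuous_perp (w : Lp ℝ 2 Q) : Continuous (perp w) := by
  unfold perp
  fun_prop

/-- The convex objective whose stationarity conditions are the nonlinear system. -/
def objective (ρ : ℝ) (f : ℝ → ℝ) (ψ κ : ℝ) (w g h : Lp ℝ 2 Q) : ℝ :=
  (Real.sqrt ψ)⁻¹ * Fk ρ f κ (inner ℝ w h) ‖perp w h‖ + inner ℝ g h

/-- The gradient of the objective at points `h` not collinear with `w`. -/
def objGrad (ρ : ℝ) (f : ℝ → ℝ) (ψ κ : ℝ) (w g h : Lp ℝ 2 Q) : Lp ℝ 2 Q :=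
  g + ((Real.sqrt ψ)⁻¹ * d1F ρ f κ (inner ℝ w h) ‖perp w h‖) • w +
    ((Real.sqrt ψ)⁻¹ * ‖perp w h‖⁻¹ * d2F ρ f κ (inner ℝ w h) ‖perp w h‖) • perp w h

variable {ρ : ℝ} {f : ℝ → ℝ} {ψ κ : ℝ} {w g r : Lp ℝ 2 Q}

theorem convexOn_objective (hfc : Continuous f) (hf : ∀ t, f t ∈ Set.Icc (0 : ℝ) 1)
    (w g : Lp ℝ 2 Q) : ConvexOn ℝ Set.univ (objective ρ f ψ κ w g) := by
  refine ⟨convex_univ, fun h _ h' _ a b ha hb hab => ?_⟩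
  have h1 : ‖perp w (a • h + b • h')‖ ≤ a * ‖perp w h‖ + b * ‖perp w h'‖ := by
    rw [perp_add, perp_smul, perp_smul]
    refine (norm_add_le _ _).trans_eq ?_
    rw [norm_smul, norm_smul, Real.norm_of_nonneg ha, Real.norm_of_nonneg hb]
  have h2 := Fk_mono_right (ρ := ρ) hfc hf κ (inner ℝ w (a • h + b • h')) (norm_nonneg _) h1
  have h3 := Fk_eq_of_eq_combo (ρ := ρ) hfc hf κ κ (inner ℝ w h) ‖perp w h‖ (inner ℝ w h')
    ‖perp w h'‖ ha hb
  rw [← add_mul, hab, one_mul] at h3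
  have h4 : (0 : ℝ) ≤ (Real.sqrt ψ)⁻¹ := by positivity
  simp only [objective, inner_add_right, inner_smul_right, smul_eq_mul] at h2 h3 ⊢
  nlinarith [mul_le_mul_of_nonneg_left (h2.trans h3) h4]

theorem continuous_objective (hfc : Continuous f) (hf : ∀ t, f t ∈ Set.Icc (0 : ℝ) 1)
    (w g : Lp ℝ 2 Q) : Continuous (objective ρ f ψ κ w g) := by
  have h1 : Continuous fun h : Lp ℝ 2 Q => ((inner ℝ w h : ℝ), ‖perp w h‖) :=
    (continuous_const.inner continuous_id).prodMk (continuous_perp w).norm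
  have h2 := (continuous_Fk (ρ := ρ) hfc hf κ).comp h1
  unfold objective
  exact (h2.const_mul _).add (continuous_const.inner continuous_id)

theorem exists_isMin_objective (hfc : Continuous f) (hf : ∀ t, f t ∈ Set.Icc (0 : ℝ) 1)
    (hψ : 0 < ψ) (hκ : 0 ≤ κ) (hr : 0 ≤ r) (hw : ‖w‖ = 1) {q : ℝ} (hwr : |w| ≤ q • r)
    (hg : ∀ ε > 0, ∃ g₀ : Lp ℝ 2 Q, ‖g - g₀‖ ≤ ε ∧ ∃ M : ℝ, |g₀| ≤ M • r) :
    ∃ h₀, wL1 r h₀ ≤ 1 ∧ ∀ h, wL1 r h ≤ 1 →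
      objective ρ f ψ κ w g h₀ ≤ objective ρ f ψ κ w g h := by
  obtain ⟨α, hα, β, hF⟩ := exists_Fk_ge (ρ := ρ) hfc hf hκ
  set ψ' := (Real.sqrt ψ)⁻¹ with hψ'
  have hψ'0 : 0 < ψ' := by positivity
  obtain ⟨g₀, hg₀, M, hM⟩ := hg (ψ' * α / 2) (by positivity)
  set ε := ψ' * α / 2 with hε
  have hε0 : 0 < ε := by positivity
  have hKc : IsClosed {h : Lp ℝ 2 Q | wL1 r h ≤ 1} :=
    isClosed_le (continuous_wL1 r) continuous_const
  have hKconv : Convex ℝ {h : Lp ℝ 2 Q | wL1 r h ≤ 1} := by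
    intro h hh h' hh' a b ha hb hab
    have h1 := wL1_add_le hr (a • h) (b • h')
    rw [wL1_smul, wL1_smul, abs_of_nonneg ha, abs_of_nonneg hb] at h1
    simp only [Set.mem_ofPred_eq] at hh hh' ⊢
    nlinarith
  refine exists_forall_le_of_convexOn_of_coercive (a := ε)
    (b := ψ' * |β| * |q| + |M| + 2 * ε * |q|) hKc
    ⟨0, by simp [wL1]⟩ ((convexOn_objective hfc hf w g).subset (Set.subset_univ _) hKconv)
    (continuous_objective hfc hf w g) hε0 fun h hh => ?_
  have hh' : wL1 r h ≤ 1 := hh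
  have hN := wL1_nonneg hr h
  have bd : ∀ {k : Lp ℝ 2 Q} {m : ℝ}, |k| ≤ m • r → |inner ℝ k h| ≤ |m| := by
    intro k m hk
    have h1 := abs_inner_le_wL1 hk h
    have h2 := le_abs_self m
    have h3 := abs_nonneg m
    nlinarith
  have h1 := bd hwr
  have h2 := bd hM
  have h3 : |inner ℝ (g - g₀) h| ≤ ε * ‖h‖ :=
    (abs_real_inner_le_norm _ _).trans (mul_le_mul_of_nonneg_right hg₀ (norm_nonneg _))
  have h4 := hF (inner ℝ w h) ‖perp w h‖
  have h5 : ‖h‖ ≤ ‖perp w h‖ + |inner ℝ w h| := by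
    have e : h = perp w h + (inner ℝ w h : ℝ) • w := by simp [perp]
    nth_rw 1 [e]
    refine (norm_add_le _ _).trans_eq ?_
    rw [norm_smul, hw, mul_one, Real.norm_eq_abs]
  have h6 : inner ℝ g h = inner ℝ (g - g₀) h + inner ℝ g₀ h := by
    rw [inner_sub_left]
    ring
  have h7 : β * |inner ℝ w h| ≤ |β| * |q| :=
    mul_le_mul (le_abs_self _) h1 (abs_nonneg _) (abs_nonneg _)
  have h8 := mul_le_mul_of_nonneg_left h4 hψ'0.le
  have h9 := mul_le_mul_of_nonneg_left h7 hψ'0.le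
  have h10 := (abs_le.1 h2).1
  have h11 := (abs_le.1 h3).1
  have h12 := mul_le_mul_of_nonneg_left h5 hε0.le
  have h13 := mul_le_mul_of_nonneg_left h1 hε0.le
  have h14 : ψ' * α = 2 * ε := by rw [hε]; ring
  have h15 : ψ' * (α * ‖perp w h‖ - β * |inner ℝ w h|) =
      2 * ε * ‖perp w h‖ - ψ' * (β * |inner ℝ w h|) := by
    rw [← h14]; ring
  unfold objective
  rw [h6]
  nlinarith

theorem nonneg_of_hasDerivWithinAt_of_le {φ : ℝ → ℝ} {φ' : ℝ}
    (h : HasDerivWithinAt φ φ' (Set.Ici 0) 0) (hle : ∀ t ∈ Set.Icc (0 : ℝ) 1, φ 0 ≤ φ t) :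
    0 ≤ φ' := by
  have h1 := (hasDerivWithinAt_iff_tendsto_slope' (by simp)).1 (h.mono Set.Ioi_subset_Ici_self)
  refine ge_of_tendsto h1 ?_
  filter_upwards [Ioo_mem_nhdsGT (zero_lt_one (α := ℝ))] with t ht
  rw [slope_def_field]
  exact div_nonneg (by linarith [hle t ⟨ht.1.le, ht.2.le⟩]) (by linarith [ht.1])

theorem objective_segment_le (hr : 0 ≤ r) {h₀ : Lp ℝ 2 Q} (hh₀ : wL1 r h₀ ≤ 1)
    (hmin : ∀ h, wL1 r h ≤ 1 → objective ρ f ψ κ w g h₀ ≤ objective ρ f ψ κ w g h)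
    {h : Lp ℝ 2 Q} (hh : wL1 r h ≤ 1) :
    ∀ t ∈ Set.Icc (0 : ℝ) 1, objective ρ f ψ κ w g (h₀ + (0 : ℝ) • (h - h₀)) ≤
      objective ρ f ψ κ w g (h₀ + t • (h - h₀)) := by
  intro t ht
  rw [zero_smul, add_zero]
  refine hmin _ ?_
  have e : h₀ + t • (h - h₀) = (1 - t) • h₀ + t • h := by module
  rw [e]
  refine (wL1_add_le hr _ _).trans ?_
  rw [wL1_smul, wL1_smul, abs_of_nonneg ht.1, abs_of_nonneg (by linarith [ht.2])]
  nlinarith [ht.1, ht.2]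

theorem objGrad_inner_le_of_isMin (hfc : Continuous f) (hf : ∀ t, f t ∈ Set.Icc (0 : ℝ) 1)
    (hκ : 0 ≤ κ) (hr : 0 ≤ r) (hw : ‖w‖ = 1) {h₀ : Lp ℝ 2 Q} (hh₀ : wL1 r h₀ ≤ 1)
    (hmin : ∀ h, wL1 r h ≤ 1 → objective ρ f ψ κ w g h₀ ≤ objective ρ f ψ κ w g h)
    (hne : ¬(κ = 0 ∧ inner ℝ w h₀ = 0 ∧ ‖perp w h₀‖ = 0)) (h : Lp ℝ 2 Q) (hh : wL1 r h ≤ 1) :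
    inner ℝ (objGrad ρ f ψ κ w g h₀) h₀ ≤ inner ℝ (objGrad ρ f ψ κ w g h₀) h := by
  rw [← sub_nonneg, ← inner_sub_right]
  refine nonneg_of_hasDerivWithinAt_of_le
    (φ := fun t : ℝ => objective ρ f ψ κ w g (h₀ + t • (h - h₀))) ?_
    (objective_segment_le hr hh₀ hmin hh)
  set v := h - h₀
  set S := Set.Ici (0 : ℝ)
  have hpos : 0 < Fk ρ f κ (inner ℝ w h₀) ‖perp w h₀‖ := Fk_pos hfc hf hκ hne
  have hline : HasDerivWithinAt (fun t : ℝ => h₀ + t • v) v S 0 := by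
    simpa using ((hasDerivWithinAt_id (0 : ℝ) S).smul_const v).const_add h₀
  have hu : HasDerivWithinAt (fun t : ℝ => (inner ℝ w (h₀ + t • v) : ℝ)) (inner ℝ w v) S 0 := by
    simpa using (hasDerivWithinAt_const (0 : ℝ) S w).inner ℝ hline
  have hg : HasDerivWithinAt (fun t : ℝ => (inner ℝ g (h₀ + t • v) : ℝ)) (inner ℝ g v) S 0 := by
    simpa using (hasDerivWithinAt_const (0 : ℝ) S g).inner ℝ hline
  have hn : ∃ n', HasDerivWithinAt (fun t : ℝ => ‖perp w (h₀ + t • v)‖) n' S 0 ∧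
      d2F ρ f κ (inner ℝ w h₀) ‖perp w h₀‖ * n' = ‖perp w h₀‖⁻¹ *
        d2F ρ f κ (inner ℝ w h₀) ‖perp w h₀‖ * inner ℝ (perp w h₀) v := by
    simp only [perp_add, perp_smul]
    rcases (norm_nonneg (perp w h₀)).eq_or_lt with h0 | h0
    · refine ⟨‖perp w v‖, ?_, ?_⟩
      · have h1 : HasDerivWithinAt (fun t : ℝ => t * ‖perp w v‖) ‖perp w v‖ S 0 := by
          simpa using (hasDerivWithinAt_id (0 : ℝ) S).mul_const ‖perp w v‖
        rw [norm_eq_zero.1 h0.symm]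
        refine h1.congr (fun t ht => ?_) (by simp)
        rw [zero_add, norm_smul, Real.norm_of_nonneg ht]
      · rw [← h0, d2F_zero_right hfc hf]
        simp
    · refine ⟨inner ℝ (perp w h₀) (perp w v) / ‖perp w h₀‖, ?_, ?_⟩
      · have h1 : HasDerivWithinAt (fun t : ℝ => perp w h₀ + t • perp w v) (perp w v) S 0 := by
          simpa using ((hasDerivWithinAt_id (0 : ℝ) S).smul_const (perp w v)).const_add (perp w h₀)
        have h2 := h1.norm_sq.sqrt (by simpa using h0.ne')
        simp only [Real.sqrt_sq (norm_nonneg _), zero_smul, add_zero] at h2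
        refine h2.congr_deriv ?_
        field_simp
      · rw [inner_perp_left hw h₀ v]
        field_simp
  obtain ⟨n', hn', hn2⟩ := hn
  have hF := Fk_hasDerivAt_comp (ρ := ρ) hfc hf κ hu hn' (by simpa using hpos)
  refine ((hF.const_mul (Real.sqrt ψ)⁻¹).add hg).congr_deriv ?_
  simp only [zero_smul, add_zero, objGrad, inner_add_left, real_inner_smul_left]
  rw [hn2]
  ring

/-- The Karush–Kuhn–Tucker conditions for the constrained objective. -/
structure IsKKT (ρ : ℝ) (f : ℝ → ℝ) (ψ κ : ℝ) (w g r h : Lp ℝ 2 Q) (s : ℝ) : Prop where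
  perp_pos : 0 < ‖perp w h‖
  pos : 0 < s
  abs_le : |objGrad ρ f ψ κ w g h| ≤ s • r
  inner_eq : inner ℝ (objGrad ρ f ψ κ w g h) h = -s
  wL1_eq : wL1 r h = 1

theorem exists_isKKT (hfc : Continuous f) (hf : ∀ t, f t ∈ Set.Icc (0 : ℝ) 1)
    (hκ : 0 ≤ κ) (hψ : psiSep ρ f < ψ) (hr : 0 ≤ r) (hw : ‖w‖ = 1)
    (hgn : ‖g‖ = 1) (hwg : inner ℝ w g = 0) {q : ℝ} (hwr : |w| ≤ q • r)
    (hg : ∀ ε > 0, ∃ g₀ : Lp ℝ 2 Q, ‖g - g₀‖ ≤ ε ∧ ∃ M : ℝ, |g₀| ≤ M • r)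
    (hgr : ∀ M : ℝ, ¬|g| ≤ M • r) : ∃ h s, IsKKT ρ f ψ κ w g r h s := by
  obtain ⟨c, hc⟩ := exists_lt_of_ciInf_lt hψ
  have hψ0 : 0 < ψ := (sq_nonneg _).trans_lt hc
  have hc' : Fk ρ f 0 c 1 < Real.sqrt ψ := Real.lt_sqrt_of_sq_lt hc
  have hsq : 0 < Real.sqrt ψ := Real.sqrt_pos.2 hψ0
  obtain ⟨h₀, hh₀, hmin⟩ := exists_isMin_objective (ρ := ρ) hfc hf hψ0 hκ hr hw hwr hg
  have hgw : perp w g = g := by simp [perp, hwg]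
  have hww : perp w w = 0 := by simp [perp, hw]
  have hne : ¬(κ = 0 ∧ inner ℝ w h₀ = 0 ∧ ‖perp w h₀‖ = 0) := by
    rintro ⟨h1, h2, h3⟩
    have h0 : h₀ = 0 := by
      have := norm_sq_eq_perp hw h₀
      rw [h2, h3] at this
      simpa using this
    set v := c • w - g with hv
    have hN := wL1_nonneg hr v
    set ε := (1 + wL1 r v)⁻¹ with hε
    have hε0 : 0 < ε := by positivity
    have h4 := hmin (ε • v) (by
      rw [wL1_smul, abs_of_pos hε0, hε, inv_mul_le_iff₀ (by positivity)]
      linarith)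
    have e1 : inner ℝ w v = c := by
      rw [hv, inner_sub_right, inner_smul_right, real_inner_self_eq_norm_sq, hw, hwg]
      ring
    have e2 : perp w v = -g := by
      rw [hv, sub_eq_add_neg, ← neg_one_smul ℝ g, perp_add, perp_smul, perp_smul, hgw, hww]
      simp
    have e3 : inner ℝ g v = -1 := by
      rw [hv, inner_sub_right, inner_smul_right, real_inner_self_eq_norm_sq, hgn, real_inner_comm,
        hwg]
      ring
    have e4 : Fk ρ f 0 0 0 = 0 := by
      have := Fk_zero_smul (ρ := ρ) hfc hf 0 0 (t := 0) le_rfl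
      simpa using this
    simp only [objective, h1, h0, perp_smul, e2, inner_smul_right, e1, e3, norm_smul, norm_neg,
      hgn, Real.norm_of_nonneg hε0.le, inner_zero_right] at h4
    rw [Fk_zero_smul hfc hf _ _ hε0.le] at h4
    simp only [perp, inner_zero_right, zero_smul, sub_zero, norm_zero, e4, mul_zero,
      add_zero] at h4
    have h5 : (Real.sqrt ψ)⁻¹ * Fk ρ f 0 c 1 < 1 := by
      rw [inv_mul_lt_iff₀ hsq]
      linarith
    nlinarith
  have hvar := objGrad_inner_le_of_isMin hfc hf hκ hr hw hh₀ hmin hne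
  obtain ⟨hs, hk⟩ := abs_le_smul_of_isMin hr hvar
  set k := objGrad ρ f ψ κ w g h₀ with hkdef
  set s := -inner ℝ k h₀ with hsdef
  have hperp : 0 < ‖perp w h₀‖ := by
    refine (norm_nonneg _).lt_of_ne' fun h0 => ?_
    obtain ⟨m, e⟩ : ∃ m : ℝ, g = k - m • w := by
      refine ⟨(Real.sqrt ψ)⁻¹ * d1F ρ f κ (inner ℝ w h₀) ‖perp w h₀‖, ?_⟩
      rw [hkdef, objGrad, norm_eq_zero.1 h0]
      simp
    refine hgr (s + |m| * q) ?_
    have e' : (s + |m| * q) • r = s • r + |m| • q • r := by rw [add_smul, mul_smul]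
    rw [e', e]
    have h3 : |m| • |w| ≤ |m| • q • r := by
      rw [← Lp.coeFn_le] at hwr ⊢
      filter_upwards [hwr, Lp.coeFn_smul |m| |w|, Lp.coeFn_smul |m| (q • r)] with x h1 h2 h3
      rw [h2, h3]
      simp only [Pi.smul_apply, smul_eq_mul]
      exact mul_le_mul_of_nonneg_left h1 (abs_nonneg _)
    calc |k - m • w| ≤ |k| + |m • w| := by
          rw [sub_eq_add_neg, ← abs_neg (m • w)]
          exact abs_add_le k (-(m • w))
      _ ≤ _ := by
          rw [L2_abs_smul]
          exact add_le_add hk h3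
  have hF : 0 < Fk ρ f κ (inner ℝ w h₀) ‖perp w h₀‖ := Fk_pos hfc hf hκ hne
  have hs0 : 0 < s := by
    refine hs.lt_of_ne' fun h0 => ?_
    have hk0 : k = 0 := by
      rw [h0, zero_smul] at hk
      exact le_antisymm ((le_abs_self k).trans hk) (neg_nonpos.1 ((neg_le_abs k).trans hk))
    set d1 := d1F ρ f κ (inner ℝ w h₀) ‖perp w h₀‖ with hd1
    set d2 := d2F ρ f κ (inner ℝ w h₀) ‖perp w h₀‖ with hd2
    have hd2pos : 0 < d2 := d2F_pos hfc hf hκ _ hperp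
    have hd10 : d1 = 0 := by
      have : inner ℝ w k = 0 := by rw [hk0, inner_zero_right]
      rw [hkdef, objGrad, inner_add_right, inner_add_right, inner_smul_right, inner_smul_right,
        inner_perp hw, real_inner_self_eq_norm_sq, hw, hwg] at this
      have h2 : (Real.sqrt ψ)⁻¹ * d1 = 0 := by linarith
      exact (mul_eq_zero.1 h2).resolve_left (by positivity)
    have hd2' : d2 = Real.sqrt ψ := by
      have h1 : g = -(((Real.sqrt ψ)⁻¹ * ‖perp w h₀‖⁻¹ * d2) • perp w h₀) := by
        rw [eq_neg_iff_add_eq_zero, ← hk0, hkdef, objGrad, ← hd1, ← hd2, hd10]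
        simp
      have h2 : ‖g‖ = (Real.sqrt ψ)⁻¹ * ‖perp w h₀‖⁻¹ * d2 * ‖perp w h₀‖ := by
        rw [h1, norm_neg, norm_smul, Real.norm_of_nonneg (by positivity)]
      rw [hgn] at h2
      field_simp at h2
      exact h2.symm
    have hgrad := fun t => Fk_gradient_le hfc hf hF (t * c) (t * 1)
    rw [← hd1, ← hd2, hd10, hd2'] at hgrad
    set B := Fk ρ f κ 0 0 + Real.sqrt ψ * ‖perp w h₀‖ + 1 with hB
    have hB0 : 0 ≤ Fk ρ f κ 0 0 := Fk_nonneg _ _ _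
    have hdiff : 0 < Real.sqrt ψ - Fk ρ f 0 c 1 := by linarith
    have ht : 0 ≤ B / (Real.sqrt ψ - Fk ρ f 0 c 1) := by positivity
    have h1 := hgrad (B / (Real.sqrt ψ - Fk ρ f 0 c 1))
    have h2 := Fk_smul_le (ρ := ρ) hfc hf κ c 1 ht
    have h3 : B / (Real.sqrt ψ - Fk ρ f 0 c 1) * (Real.sqrt ψ - Fk ρ f 0 c 1) = B := by
      field_simp
    nlinarith
  refine ⟨h₀, s, hperp, hs0, hk, by rw [hsdef]; ring, le_antisymm hh₀ ?_⟩
  have h1 := (abs_le.1 (abs_inner_le_wL1 hk h₀)).1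
  have h2 : -s = inner ℝ k h₀ := by rw [hsdef]; ring
  rw [← h2] at h1
  nlinarith

theorem IsKKT.inner_le {h h' : Lp ℝ 2 Q} {s : ℝ} (hk : IsKKT ρ f ψ κ w g r h s)
    (hh' : wL1 r h' ≤ 1) :
    inner ℝ (objGrad ρ f ψ κ w g h) h ≤ inner ℝ (objGrad ρ f ψ κ w g h) h' := by
  have h1 := (_root_.abs_le.1 (abs_inner_le_wL1 hk.abs_le h')).1
  rw [hk.inner_eq]
  nlinarith [hk.pos]

theorem IsKKT.unique (hfc : Continuous f) (hf : ∀ t, f t ∈ Set.Icc (0 : ℝ) 1)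
    (hκ : 0 ≤ κ) (hψ : 0 < ψ) (hw : ‖w‖ = 1) {h h' : Lp ℝ 2 Q} {s s' : ℝ}
    (hk : IsKKT ρ f ψ κ w g r h s) (hk' : IsKKT ρ f ψ κ w g r h' s') : h = h' ∧ s = s' := by
  suffices hh : h = h' by
    refine ⟨hh, ?_⟩
    have h1 := hk.inner_eq
    have h2 := hk'.inner_eq
    rw [← hh] at h2
    linarith
  have i1 := hk.inner_le hk'.wL1_eq.le
  have i2 := hk'.inner_le hk.wL1_eq.le
  have hp := hk.perp_pos
  have hp' := hk'.perp_pos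
  have hF : 0 < Fk ρ f κ (inner ℝ w h) ‖perp w h‖ := Fk_pos hfc hf hκ fun H => hp.ne' H.2.2
  have hF' : 0 < Fk ρ f κ (inner ℝ w h') ‖perp w h'‖ := Fk_pos hfc hf hκ fun H => hp'.ne' H.2.2
  have g1 := Fk_gradient_le hfc hf hF (inner ℝ w h') ‖perp w h'‖
  have g2 := Fk_gradient_le hfc hf hF' (inner ℝ w h) ‖perp w h‖
  have d2 := d2F_pos (ρ := ρ) hfc hf hκ (inner ℝ w h) hp
  have d2' := d2F_pos (ρ := ρ) hfc hf hκ (inner ℝ w h') hp'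
  have hrig := eq_smul_of_Fk_gradient_eq hfc hf hF (c₁' := inner ℝ w h') hp hp'
  have hcs := real_inner_le_norm (perp w h) (perp w h')
  have hcseq := inner_eq_norm_mul_iff_real (x := perp w h) (y := perp w h')
  simp only [objGrad, inner_add_left, real_inner_smul_left] at i1 i2
  rw [inner_perp_left hw h h, inner_perp_left hw h h', real_inner_self_eq_norm_sq] at i1
  rw [inner_perp_left hw h' h, inner_perp_left hw h' h', real_inner_self_eq_norm_sq,
    real_inner_comm (perp w h)] at i2
  have hψ' : 0 < (Real.sqrt ψ)⁻¹ := by positivity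
  set c₁ : ℝ := inner ℝ w h with hc1
  set c₁' : ℝ := inner ℝ w h' with hc1'
  set c₂ := ‖perp w h‖ with hc2
  set c₂' := ‖perp w h'‖ with hc2'
  set e : ℝ := inner ℝ (perp w h) (perp w h')
  set D2 := d2F ρ f κ c₁ c₂
  set D2' := d2F ρ f κ c₁' c₂'
  set D1 := d1F ρ f κ c₁ c₂
  set D1' := d1F ρ f κ c₁' c₂'
  set p := (Real.sqrt ψ)⁻¹
  set gap := c₂ * c₂' - e with hgap
  have hgap0 : 0 ≤ gap := by linarith
  have j : D1 * (c₁ - c₁') + D1' * (c₁' - c₁) + D2 * (c₂ - c₂') + D2' * (c₂' - c₂) +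
      (D2 * c₂⁻¹ + D2' * c₂'⁻¹) * gap ≤ 0 := by
    have e1 : p * c₂⁻¹ * D2 * c₂ ^ 2 = p * (D2 * c₂) := by field_simp
    have e2 : p * c₂'⁻¹ * D2' * c₂' ^ 2 = p * (D2' * c₂') := by field_simp
    have e3 : D2 * c₂⁻¹ * (c₂ * c₂') = D2 * c₂' := by field_simp
    have e4 : D2' * c₂'⁻¹ * (c₂ * c₂') = D2' * c₂ := by field_simp
    rw [e1] at i1
    rw [e2] at i2
    have : p * (D1 * (c₁ - c₁') + D1' * (c₁' - c₁) + D2 * (c₂ - c₂') + D2' * (c₂' - c₂) +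
      (D2 * c₂⁻¹ + D2' * c₂'⁻¹) * gap) ≤ 0 := by
      have : (D2 * c₂⁻¹ + D2' * c₂'⁻¹) * gap =
          D2 * c₂' + D2' * c₂ - (D2 * c₂⁻¹ + D2' * c₂'⁻¹) * e := by
        rw [hgap, ← e3, ← e4]; ring
      rw [this]
      nlinarith
    exact nonpos_of_mul_nonpos_right this hψ'
  have hcoef : 0 < D2 * c₂⁻¹ + D2' * c₂'⁻¹ := by positivity
  have hgap1 : gap = 0 := by
    have : (D2 * c₂⁻¹ + D2' * c₂'⁻¹) * gap ≤ 0 := by linarith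
    exact le_antisymm (nonpos_of_mul_nonpos_right this hcoef) hgap0
  rw [hgap1, mul_zero, add_zero] at j
  obtain ⟨t, ht, -, ht1, ht2⟩ := hrig (by linarith)
  have hpp := hcseq.1 (by linarith)
  have hperp : perp w h' = t • perp w h := by
    have : c₂ • perp w h' = c₂ • t • perp w h := by
      rw [← hpp, ht2, smul_smul, mul_comm]
    exact smul_right_injective _ hp.ne' this
  have hh : h' = t • h := by
    have e1 : h = perp w h + c₁ • w := by simp [perp, hc1]
    have e2 : h' = perp w h' + c₁' • w := by simp [perp, hc1']
    rw [e2, hperp, ht1, mul_smul, ← smul_add, ← e1]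
  have hN := hk'.wL1_eq
  rw [hh, wL1_smul, hk.wL1_eq, abs_of_nonneg ht, mul_one] at hN
  rw [hh, hN, one_smul]

end Problem

section Prox

theorem prox_eq_sub {s : ℝ} (hs : 0 ≤ s) (t : ℝ) :
    prox s t = max (t - s) 0 - max (-t - s) 0 := by
  unfold prox
  rcases lt_trichotomy t 0 with h | h | h
  · rw [Real.sign_of_neg h, abs_of_neg h, max_eq_right (by linarith : t - s ≤ 0)]
    ring
  · simp [h, Real.sign_zero, hs]
  · rw [Real.sign_of_pos h, abs_of_pos h, max_eq_right (by linarith : -t - s ≤ 0)]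
    ring

theorem continuous_prox {s : ℝ} (hs : 0 ≤ s) : Continuous (prox s) := by
  have h : prox s = fun t => max (t - s) 0 - max (-t - s) 0 := funext (prox_eq_sub hs)
  rw [h]
  fun_prop

theorem abs_prox_le {s : ℝ} (hs : 0 ≤ s) (t : ℝ) : |prox s t| ≤ |t| := by
  rw [prox_eq_sub hs, abs_le]
  constructor <;> cases max_cases (t - s) 0 <;> cases max_cases (-t - s) 0 <;>
    cases abs_cases t <;> linarith

/-- The proximal operator is characterized by the subdifferential inclusion. -/
theorem eq_prox_iff {s u y : ℝ} (hs : 0 ≤ s) :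
    y = prox s u ↔ |u - y| ≤ s ∧ (u - y) * y = s * |y| := by
  rw [prox_eq_sub hs]
  constructor
  · intro h
    rcases le_total u (-s) with h1 | h1
    · have hy : y = u + s := by
        rw [h, max_eq_right (by linarith), max_eq_left (by linarith)]; ring
      rw [hy, abs_of_nonpos (by linarith : u + s ≤ 0), abs_le]
      exact ⟨⟨by linarith, by linarith⟩, by ring⟩
    rcases le_total u s with h2 | h2
    · have hy : y = 0 := by
        rw [h, max_eq_right (by linarith), max_eq_right (by linarith)]; ring
      rw [hy, abs_le]
      exact ⟨⟨by linarith, by linarith⟩, by simp⟩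
    · have hy : y = u - s := by
        rw [h, max_eq_left (by linarith), max_eq_right (by linarith)]; ring
      rw [hy, abs_of_nonneg (by linarith : 0 ≤ u - s), abs_le]
      exact ⟨⟨by linarith, by linarith⟩, by ring⟩
  · rintro ⟨h1, h2⟩
    obtain ⟨h3, h4⟩ := abs_le.1 h1
    rcases lt_trichotomy y 0 with h | h | h
    · rw [abs_of_neg h] at h2
      have : u - y = -s := mul_right_cancel₀ h.ne (by linarith)
      rw [max_eq_right (by linarith), max_eq_left (by linarith)]
      linarith
    · rw [h] at h3 h4 ⊢
      rw [max_eq_right (by linarith), max_eq_right (by linarith)]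
      ring
    · rw [abs_of_pos h] at h2
      have : u - y = s := mul_right_cancel₀ h.ne' (by linarith)
      rw [max_eq_left (by linarith), max_eq_right (by linarith)]
      linarith

theorem eq_neg_prox_iff {s D r a h : ℝ} (hs : 0 < s) (hD : 0 < D) (hr : 0 < r) :
    h = -(r * prox s (r⁻¹ * a) / D) ↔
      |a + D * h| ≤ s * r ∧ (a + D * h) * h = -(s * r * |h|) := by
  obtain ⟨y, rfl⟩ : ∃ y, h = -(r * y / D) := ⟨-(D * h / r), by field_simp⟩
  have e1 : -(r * y / D) = -(r * prox s (r⁻¹ * a) / D) ↔ y = prox s (r⁻¹ * a) := by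
    rw [neg_inj, div_left_inj' hD.ne', mul_right_inj' hr.ne']
  have e2 : a + D * -(r * y / D) = r * (r⁻¹ * a - y) := by field_simp; ring
  rw [e1, eq_prox_iff hs.le, e2, abs_mul, abs_of_pos hr, mul_comm s r, mul_le_mul_iff_right₀ hr]
  refine and_congr_right fun _ => ?_
  rw [abs_neg, abs_div, abs_mul, abs_of_pos hr, abs_of_pos hD]
  set v := r⁻¹ * a - y
  have e3 : r * v * -(r * y / D) = -(r ^ 2 / D) * (v * y) := by ring
  have e4 : -(r * s * (r * |y| / D)) = -(r ^ 2 / D) * (s * |y|) := by ring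
  have hne : -(r ^ 2 / D) ≠ 0 := neg_ne_zero.2 (by positivity)
  rw [e3, e4, mul_right_inj' hne]

end Prox

theorem L2_inner_eq_integral {Ω : Type*} [MeasurableSpace Ω] {Q : Measure Ω} {u v : Lp ℝ 2 Q}
    {a b : Ω → ℝ} (hu : u =ᵐ[Q] a) (hv : v =ᵐ[Q] b) : inner ℝ u v = ∫ x, a x * b x ∂Q := by
  rw [L2.inner_def]
  refine integral_congr_ae ?_
  filter_upwards [hu, hv] with x h1 h2
  simp only [h1, h2, RCLike.inner_apply, conj_trivial]
  ring

/-- For elements of unit weighted `L¹` norm, the dual optimality conditions hold pointwise. -/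
theorem abs_le_and_inner_eq_iff {Ω : Type*} [MeasurableSpace Ω] {Q : Measure Ω}
    {k r h : Lp ℝ 2 Q} {s : ℝ} (hN : wL1 r h = 1) :
    (|k| ≤ s • r ∧ inner ℝ k h = -s) ↔
      ∀ᵐ x ∂Q, |k x| ≤ s * r x ∧ k x * h x = -(s * r x * |h x|) := by
  have hle : |k| ≤ s • r ↔ ∀ᵐ x ∂Q, |k x| ≤ s * r x := by
    rw [← Lp.coeFn_le]
    refine eventually_congr ?_
    filter_upwards [Lp.coeFn_abs k, Lp.coeFn_smul s r] with x h1 h2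
    rw [h1, h2, Pi.smul_apply, smul_eq_mul]
  have hN' : inner ℝ r |h| = (1 : ℝ) := hN
  rw [L2_inner_eq_integral (ae_eq_refl _) (Lp.coeFn_abs h)] at hN'
  have i1 : Integrable (fun x => k x * h x) Q := by
    simpa [RCLike.inner_apply, mul_comm] using L2.integrable_inner (𝕜 := ℝ) k h
  have i2 : Integrable (fun x => r x * |h x|) Q :=
    Integrable.of_integral_ne_zero (by rw [hN']; exact one_ne_zero)
  have hsum : ∫ x, (k x * h x + s * (r x * |h x|)) ∂Q = inner ℝ k h + s := by
    rw [integral_add i1 (i2.const_mul s), integral_const_mul, hN', mul_one,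
      L2_inner_eq_integral (ae_eq_refl k) (ae_eq_refl h)]
  rw [hle, eventually_and]
  refine and_congr_right fun hk => ?_
  have hnn : 0 ≤ᵐ[Q] fun x => k x * h x + s * (r x * |h x|) := by
    filter_upwards [hk] with x hx
    have h1 := mul_le_mul_of_nonneg_right hx (abs_nonneg (h x))
    rw [← abs_mul] at h1
    have h2 := neg_abs_le (k x * h x)
    simp only [Pi.zero_apply]
    linarith
  rw [← add_eq_zero_iff_eq_neg, ← hsum,
    integral_eq_zero_iff_of_nonneg_ae hnn (i1.add (i2.const_mul s))]
  refine eventually_congr (Eventually.of_forall fun x => ?_)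
  rw [Pi.zero_apply, ← add_eq_zero_iff_eq_neg, mul_assoc]

section System

variable {ρ : ℝ} {f : ℝ → ℝ} {ψ κ : ℝ} {μ : Measure (ℝ × ℝ)}
  {w g r h : Lp ℝ 2 (μ.prod _root_.stdGaussian)} {c₁ c₂ s : ℝ}

/-- The element of `L²` attached to a candidate solution `(c₁, c₂, s)`. -/
def systemDirection (ρ : ℝ) (f : ℝ → ℝ) (ψ κ c₁ c₂ s : ℝ) (q : (ℝ × ℝ) × ℝ) : ℝ :=
  -((Real.sqrt q.1.1)⁻¹ * Tcal ρ f ψ κ c₁ c₂ s q / Dval ρ f ψ κ c₁ c₂)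

theorem memLp_systemDirection [IsProbabilityMeasure μ] (hs : 0 < s)
    (hpos : ∀ᵐ q ∂(μ.prod _root_.stdGaussian), 0 < q.1.1)
    (hw : w =ᵐ[μ.prod _root_.stdGaussian] fun q => q.1.2)
    (hg : g =ᵐ[μ.prod _root_.stdGaussian] fun q => q.2) :
    MemLp (systemDirection ρ f ψ κ c₁ c₂ s) 2 (μ.prod _root_.stdGaussian) := by
  set b := (Real.sqrt ψ)⁻¹ * (d1F ρ f κ c₁ c₂ - c₁ * c₂⁻¹ * d2F ρ f κ c₁ c₂) with hb
  set D := Dval ρ f ψ κ c₁ c₂ with hD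
  have hmem := ((Lp.memLp g).add ((Lp.memLp w).const_mul b)).const_mul D⁻¹
  refine hmem.of_le ?_ ?_
  · have hT : Measurable (Tcal ρ f ψ κ c₁ c₂ s) := by
      refine (continuous_prox hs.le).measurable.comp ?_
      fun_prop
    refine Measurable.aestronglyMeasurable ?_
    exact (((by fun_prop : Measurable fun q : (ℝ × ℝ) × ℝ => (Real.sqrt q.1.1)⁻¹).mul
      hT).div_const _).neg
  · filter_upwards [hpos, hw, hg] with q h0 h1 h2
    have hsq : 0 < Real.sqrt q.1.1 := Real.sqrt_pos.2 h0
    have hle := abs_prox_le hs.le (Real.sqrt q.1.1 * q.2 + b * Real.sqrt q.1.1 * q.1.2)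
    have e : Real.sqrt q.1.1 * q.2 + b * Real.sqrt q.1.1 * q.1.2 =
      Real.sqrt q.1.1 * (q.2 + b * q.1.2) := by ring
    have hT : |Tcal ρ f ψ κ c₁ c₂ s q| ≤ Real.sqrt q.1.1 * |q.2 + b * q.1.2| := by
      rw [e, abs_mul, abs_of_pos hsq] at hle
      rw [← e] at hle
      exact hle
    simp only [systemDirection, Pi.add_apply, h1, h2, Real.norm_eq_abs, abs_neg, abs_mul,
      abs_div, abs_inv, abs_of_pos hsq]
    rw [div_eq_inv_mul]
    refine mul_le_mul_of_nonneg_left ?_ (by positivity)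
    rwa [inv_mul_le_iff₀ hsq]

theorem coeFn_objGrad (hw : w =ᵐ[μ.prod _root_.stdGaussian] fun q => q.1.2)
    (hg : g =ᵐ[μ.prod _root_.stdGaussian] fun q => q.2) (h1 : inner ℝ w h = c₁)
    (h2 : ‖perp w h‖ = c₂) :
    objGrad ρ f ψ κ w g h =ᵐ[μ.prod _root_.stdGaussian] fun q =>
      (q.2 + (Real.sqrt ψ)⁻¹ * (d1F ρ f κ c₁ c₂ - c₁ * c₂⁻¹ * d2F ρ f κ c₁ c₂) * q.1.2) +
        Dval ρ f ψ κ c₁ c₂ * h q := by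
  set b := (Real.sqrt ψ)⁻¹ * (d1F ρ f κ c₁ c₂ - c₁ * c₂⁻¹ * d2F ρ f κ c₁ c₂) with hb
  have e : objGrad ρ f ψ κ w g h = g + b • w + Dval ρ f ψ κ c₁ c₂ • h := by
    rw [objGrad, h1, h2, perp, h1, hb, Dval]
    module
  rw [e]
  filter_upwards [hw, hg, Lp.coeFn_add (g + b • w) (Dval ρ f ψ κ c₁ c₂ • h),
    Lp.coeFn_add g (b • w), Lp.coeFn_smul b w, Lp.coeFn_smul (Dval ρ f ψ κ c₁ c₂) h]
    with q a1 a2 a3 a4 a5 a6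
  rw [a3, Pi.add_apply, a4, Pi.add_apply, a5, a6, Pi.smul_apply, Pi.smul_apply, a1, a2,
    smul_eq_mul, smul_eq_mul]

theorem ae_eq_systemDirection_iff
    (hpos : ∀ᵐ q ∂(μ.prod _root_.stdGaussian), 0 < q.1.1)
    (hw : w =ᵐ[μ.prod _root_.stdGaussian] fun q => q.1.2)
    (hg : g =ᵐ[μ.prod _root_.stdGaussian] fun q => q.2)
    (hr : r =ᵐ[μ.prod _root_.stdGaussian] fun q => (Real.sqrt q.1.1)⁻¹)
    (hs : 0 < s) (hD : 0 < Dval ρ f ψ κ c₁ c₂) (hN : wL1 r h = 1)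
    (h1 : inner ℝ w h = c₁) (h2 : ‖perp w h‖ = c₂) :
    (|objGrad ρ f ψ κ w g h| ≤ s • r ∧ inner ℝ (objGrad ρ f ψ κ w g h) h = -s) ↔
      h =ᵐ[μ.prod _root_.stdGaussian] systemDirection ρ f ψ κ c₁ c₂ s := by
  rw [abs_le_and_inner_eq_iff hN]
  refine eventually_congr ?_
  filter_upwards [hpos, hr, coeFn_objGrad hw hg h1 h2] with q h0 h3 h4
  have hsq : 0 < (Real.sqrt q.1.1)⁻¹ := inv_pos.2 (Real.sqrt_pos.2 h0)
  rw [h3, h4, ← eq_neg_prox_iff hs hD hsq, systemDirection, Tcal, inv_inv]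
  ring_nf

theorem solvesSystem_iff
    (hpos : ∀ᵐ q ∂(μ.prod _root_.stdGaussian), 0 < q.1.1)
    (hw : w =ᵐ[μ.prod _root_.stdGaussian] fun q => q.1.2)
    (hr : r =ᵐ[μ.prod _root_.stdGaussian] fun q => (Real.sqrt q.1.1)⁻¹)
    (hh : h =ᵐ[μ.prod _root_.stdGaussian] systemDirection ρ f ψ κ c₁ c₂ s) :
    SolvesSystem ρ f ψ κ μ c₁ c₂ s ↔
      inner ℝ w h = c₁ ∧ ‖h‖ ^ 2 = c₁ ^ 2 + c₂ ^ 2 ∧ wL1 r h = 1 := by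
  have e1 : inner ℝ w h = -∫ q, (Real.sqrt q.1.1)⁻¹ * q.1.2 * Tcal ρ f ψ κ c₁ c₂ s q /
      Dval ρ f ψ κ c₁ c₂ ∂(μ.prod _root_.stdGaussian) := by
    rw [L2_inner_eq_integral hw hh, ← integral_neg]
    refine integral_congr_ae (Eventually.of_forall fun q => ?_)
    simp only [systemDirection]
    ring
  have e2 : ‖h‖ ^ 2 = ∫ q, ((Real.sqrt q.1.1)⁻¹ * Tcal ρ f ψ κ c₁ c₂ s q /
      Dval ρ f ψ κ c₁ c₂) ^ 2 ∂(μ.prod _root_.stdGaussian) := by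
    rw [← real_inner_self_eq_norm_sq, L2_inner_eq_integral hh hh]
    refine integral_congr_ae (Eventually.of_forall fun q => ?_)
    simp only [systemDirection]
    ring
  have e3 : wL1 r h = ∫ q, |q.1.1⁻¹ * Tcal ρ f ψ κ c₁ c₂ s q / Dval ρ f ψ κ c₁ c₂|
      ∂(μ.prod _root_.stdGaussian) := by
    rw [wL1, L2_inner_eq_integral hr (Lp.coeFn_abs h)]
    refine integral_congr_ae ?_
    filter_upwards [hpos, hh] with q h0 h1
    have hsq : 0 < (Real.sqrt q.1.1)⁻¹ := inv_pos.2 (Real.sqrt_pos.2 h0)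
    have hi : q.1.1⁻¹ = (Real.sqrt q.1.1)⁻¹ * (Real.sqrt q.1.1)⁻¹ := by
      rw [← mul_inv, Real.mul_self_sqrt h0.le]
    rw [h1, systemDirection, abs_neg, hi, mul_assoc, mul_div_assoc _ (_ * _), abs_mul (Real.sqrt q.1.1)⁻¹,
      abs_of_pos hsq]
  rw [SolvesSystem, ← e1, ← e2, ← e3, eq_comm, eq_comm (b := ‖h‖ ^ 2), eq_comm (b := wL1 r h)]

end System

section Data

variable {μ : Measure (ℝ × ℝ)} [IsProbabilityMeasure μ] {c C' : ℝ}

theorem ae_prod_of_support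
    (hμ_supp : μ {q : ℝ × ℝ | q.1 ∈ Set.Icc c c⁻¹ ∧ q.2 ∈ Set.Icc (-C') C'} = 1) :
    ∀ᵐ q ∂(μ.prod _root_.stdGaussian), q.1.1 ∈ Set.Icc c c⁻¹ ∧ |q.1.2| ≤ C' := by
  have hm : MeasurableSet {q : ℝ × ℝ | q.1 ∈ Set.Icc c c⁻¹ ∧ q.2 ∈ Set.Icc (-C') C'} :=
    (measurable_fst measurableSet_Icc).inter (measurable_snd measurableSet_Icc)
  have h1 : ∀ᵐ q ∂μ, q.1 ∈ Set.Icc c c⁻¹ ∧ q.2 ∈ Set.Icc (-C') C' :=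
    (prob_compl_eq_zero_iff hm).2 hμ_supp
  filter_upwards [Measure.quasiMeasurePreserving_fst.ae h1] with q hq
  exact ⟨hq.1, abs_le.2 hq.2⟩

theorem integral_sq_stdGaussian : ∫ x : ℝ, x * x ∂_root_.stdGaussian = 1 := by
  have h1 : Var[fun x => x; gaussianReal 0 1] = 1 := by simp [variance_fun_id_gaussianReal]
  rw [variance_of_integral_eq_zero (by fun_prop) (by simp)] at h1
  simpa [_root_.stdGaussian, pow_two] using h1

theorem stdGaussian_integral_id : ∫ x : ℝ, x ∂_root_.stdGaussian = 0 := by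
  simp [_root_.stdGaussian]

theorem exists_bounded_norm_sub_le {Ω : Type*} [MeasurableSpace Ω] {Q : Measure Ω}
    (g : Lp ℝ 2 Q) {r : Lp ℝ 2 Q} {δ : ℝ} (hδ : 0 < δ) (hr : ∀ᵐ x ∂Q, δ ≤ r x) {ε : ℝ}
    (hε : 0 < ε) : ∃ g₀ : Lp ℝ 2 Q, ‖g - g₀‖ ≤ ε ∧ ∃ M : ℝ, |g₀| ≤ M • r := by
  obtain ⟨u, hu, hu2⟩ := (Lp.memLp g).exists_simpleFunc_eLpNorm_sub_lt (by simp)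
    (ENNReal.ofReal_pos.2 hε).ne'
  obtain ⟨B, hB⟩ := u.exists_forall_norm_le
  refine ⟨hu2.toLp u, ?_, |B| / δ, ?_⟩
  · rw [← Lp.toLp_coeFn g (Lp.memLp g), ← MemLp.toLp_sub, Lp.norm_toLp]
    exact ENNReal.toReal_le_of_le_ofReal hε.le hu.le
  · rw [← Lp.coeFn_le]
    filter_upwards [hr, Lp.coeFn_abs (hu2.toLp u), hu2.coeFn_toLp,
      Lp.coeFn_smul (|B| / δ) r] with x h1 h2 h3 h4
    rw [h2, h3, h4, Pi.smul_apply, smul_eq_mul, ← Real.norm_eq_abs, div_mul_eq_mul_div,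
      le_div_iff₀ hδ]
    exact mul_le_mul ((hB x).trans (le_abs_self B)) h1 hδ.le (abs_nonneg B)

theorem not_ae_abs_snd_le (K : ℝ) :
    ¬∀ᵐ q ∂(μ.prod _root_.stdGaussian), |q.2| ≤ K := by
  intro h
  have h1 : (μ.prod _root_.stdGaussian) (Set.univ ×ˢ Set.Ioi K) = 0 := by
    refine measure_mono_null (fun q hq => ?_) (ae_iff.1 h)
    exact not_le.2 ((Set.mem_Ioi.1 hq.2).trans_le (le_abs_self _))
  rw [Measure.prod_prod, measure_univ, one_mul] at h1
  exact (isOpen_Ioi.measure_pos _root_.stdGaussian ⟨K + 1, by simp⟩).ne' h1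

/-- The coordinates of `μ ⊗ N(0,1)` satisfy the hypotheses of the abstract problem. -/
theorem exists_coordinates (hc0 : 0 < c) (hC' : 0 < C')
    (hμ_supp : μ {q : ℝ × ℝ | q.1 ∈ Set.Icc c c⁻¹ ∧ q.2 ∈ Set.Icc (-C') C'} = 1)
    (hμ_mom2 : ∫ q, q.2 ^ 2 ∂μ = 1) :
    ∃ w g r : Lp ℝ 2 (μ.prod _root_.stdGaussian),
      (w =ᵐ[μ.prod _root_.stdGaussian] fun q => q.1.2) ∧
      (g =ᵐ[μ.prod _root_.stdGaussian] fun q => q.2) ∧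
      (r =ᵐ[μ.prod _root_.stdGaussian] fun q => (Real.sqrt q.1.1)⁻¹) ∧
      0 ≤ r ∧ ‖w‖ = 1 ∧ ‖g‖ = 1 ∧ inner ℝ w g = (0 : ℝ) ∧ (∃ q : ℝ, |w| ≤ q • r) ∧
      (∀ ε > 0, ∃ g₀ : Lp ℝ 2 (μ.prod _root_.stdGaussian), ‖g - g₀‖ ≤ ε ∧
        ∃ M : ℝ, |g₀| ≤ M • r) ∧
      ∀ M : ℝ, ¬|g| ≤ M • r := by
  have hsupp := ae_prod_of_support hμ_supp
  have hsc : 0 < Real.sqrt c := Real.sqrt_pos.2 hc0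
  have hrb : ∀ᵐ q ∂(μ.prod _root_.stdGaussian),
      Real.sqrt c ≤ (Real.sqrt q.1.1)⁻¹ ∧ (Real.sqrt q.1.1)⁻¹ ≤ (Real.sqrt c)⁻¹ := by
    filter_upwards [hsupp] with q hq
    have h1 : Real.sqrt c ≤ Real.sqrt q.1.1 := Real.sqrt_le_sqrt hq.1.1
    have h2 : Real.sqrt q.1.1 ≤ (Real.sqrt c)⁻¹ := by
      rw [← Real.sqrt_inv]
      exact Real.sqrt_le_sqrt hq.1.2
    exact ⟨(le_inv_comm₀ (hsc.trans_le h1) hsc).1 h2, inv_anti₀ hsc h1⟩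
  have mw : MemLp (fun q : (ℝ × ℝ) × ℝ => q.1.2) 2 (μ.prod _root_.stdGaussian) :=
    MemLp.of_bound (by fun_prop) C' (hsupp.mono fun q hq => hq.2)
  have mg : MemLp (fun q : (ℝ × ℝ) × ℝ => q.2) 2 (μ.prod _root_.stdGaussian) :=
    memLp_id_stdGaussian.comp_measurePreserving measurePreserving_snd
  have mr : MemLp (fun q : (ℝ × ℝ) × ℝ => (Real.sqrt q.1.1)⁻¹) 2
      (μ.prod _root_.stdGaussian) := by
    refine MemLp.of_bound (by fun_prop) (Real.sqrt c)⁻¹ (hrb.mono fun q hq => ?_)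
    rw [Real.norm_of_nonneg (by positivity)]
    exact hq.2
  have hw := mw.coeFn_toLp
  have hg := mg.coeFn_toLp
  have hr := mr.coeFn_toLp
  have hrδ : ∀ᵐ q ∂(μ.prod _root_.stdGaussian), Real.sqrt c ≤ mr.toLp _ q := by
    filter_upwards [hrb, hr] with q h1 h2
    rw [h2]
    exact h1.1
  refine ⟨mw.toLp _, mg.toLp _, mr.toLp _, hw, hg, hr, ?_, ?_, ?_, ?_, ⟨C' / Real.sqrt c, ?_⟩,
    fun ε hε => exists_bounded_norm_sub_le _ hsc hrδ hε, fun M hM => ?_⟩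
  · rw [← Lp.coeFn_nonneg]
    exact hrδ.mono fun q hq => hsc.le.trans hq
  · have h : ‖mw.toLp _‖ ^ 2 = 1 := by
      rw [← real_inner_self_eq_norm_sq, L2_inner_eq_integral hw hw]
      have := integral_fun_fst (μ := μ) (ν := _root_.stdGaussian) fun x : ℝ × ℝ => x.2 * x.2
      rw [this]
      simpa [pow_two] using hμ_mom2
    exact (pow_eq_one_iff_of_nonneg (norm_nonneg _) two_ne_zero).1 h
  · have h : ‖mg.toLp _‖ ^ 2 = 1 := by
      rw [← real_inner_self_eq_norm_sq, L2_inner_eq_integral hg hg]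
      have := integral_fun_snd (μ := μ) (ν := _root_.stdGaussian) fun x : ℝ => x * x
      rw [this]
      simp [integral_sq_stdGaussian]
    exact (pow_eq_one_iff_of_nonneg (norm_nonneg _) two_ne_zero).1 h
  · rw [L2_inner_eq_integral hw hg]
    have := integral_prod_mul (μ := μ) (ν := _root_.stdGaussian) (fun x : ℝ × ℝ => x.2)
      fun x : ℝ => x
    rw [this, stdGaussian_integral_id, mul_zero]
  · rw [← Lp.coeFn_le]
    filter_upwards [hsupp, hrδ, Lp.coeFn_abs (mw.toLp _), hw,
      Lp.coeFn_smul (C' / Real.sqrt c) (mr.toLp _)] with q h1 h2 h3 h4 h5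
    rw [h3, h4, h5, Pi.smul_apply, smul_eq_mul, div_mul_eq_mul_div, le_div_iff₀ hsc]
    exact mul_le_mul h1.2 h2 hsc.le hC'.le
  · refine not_ae_abs_snd_le (μ := μ) (|M| * (Real.sqrt c)⁻¹) ?_
    rw [← Lp.coeFn_le] at hM
    filter_upwards [hM, hrb, Lp.coeFn_abs (mg.toLp _), hg, hr,
      Lp.coeFn_smul M (mr.toLp _)] with q h1 h2 h3 h4 h5 h6
    rw [h3, h4, h6, Pi.smul_apply, h5, smul_eq_mul] at h1
    refine h1.trans (mul_le_mul (le_abs_self M) h2.2 (hsc.le.trans h2.1) (abs_nonneg M))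

end Data

theorem Dval_pos {ρ : ℝ} {f : ℝ → ℝ} (hfc : Continuous f) (hf : ∀ t, f t ∈ Set.Icc (0 : ℝ) 1)
    {ψ κ : ℝ} (hψ : 0 < ψ) (hκ : 0 ≤ κ) (c₁ : ℝ) {c₂ : ℝ} (h2 : 0 < c₂) :
    0 < Dval ρ f ψ κ c₁ c₂ := by
  have := d2F_pos (ρ := ρ) hfc hf hκ c₁ h2
  unfold Dval
  positivity

/-- **Proposition 2.1 (uniqueness).** For `ψ > ψ↓(κ)` the nonlinear system has exactly one
solution `(c₁, c₂, s) ∈ ℝ × (0,∞) × (0,∞)`. -/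
theorem system_unique_solution
    (ρ : ℝ) (hρ : 0 < ρ)
    (f : ℝ → ℝ) (hf_cont : Continuous f) (hf_mono : Monotone f)
    (hf_range : ∀ t, f t ∈ Set.Icc (0 : ℝ) 1)
    (μ : Measure (ℝ × ℝ)) (hμ_prob : IsProbabilityMeasure μ)
    (c C' C'' : ℝ) (hc0 : 0 < c) (hc1 : c < 1) (hC' : 0 < C') (hC'' : 0 < C'')
    (hμ_supp : μ {q : ℝ × ℝ | q.1 ∈ Set.Icc c c⁻¹ ∧ q.2 ∈ Set.Icc (-C') C'} = 1)
    (hμ_mom2 : ∫ q, q.2 ^ 2 ∂μ = 1) (hμ_mom1 : C'' ≤ ∫ q, |q.2| ∂μ)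
    (κ ψ : ℝ) (hκ : 0 ≤ κ) (hψ : psiDown ρ f μ κ < ψ) :
    ∃! t : ℝ × ℝ × ℝ, 0 < t.2.1 ∧ 0 < t.2.2 ∧ SolvesSystem ρ f ψ κ μ t.1 t.2.1 t.2.2 := by
  have hsep : psiSep ρ f < ψ := (le_max_left _ _).trans_lt hψ
  have hψ0 : 0 < ψ := (Real.iInf_nonneg fun _ => sq_nonneg _).trans_lt hsep
  have hpos : ∀ᵐ q ∂(μ.prod _root_.stdGaussian), 0 < q.1.1 :=
    (ae_prod_of_support hμ_supp).mono fun q hq => hc0.trans_le hq.1.1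
  obtain ⟨w, g, r, hw, hg, hr, hr0, hwn, hgn, hwg, ⟨q, hwr⟩, hgapx, hgr⟩ :=
    exists_coordinates hc0 hC' hμ_supp hμ_mom2
  have hD := fun c₁ : ℝ => fun {c₂ : ℝ} => Dval_pos (ρ := ρ) hf_cont hf_range hψ0 hκ c₁ (c₂ := c₂)
  obtain ⟨h, s, hk⟩ := exists_isKKT hf_cont hf_range hκ hsep hr0 hwn hgn hwg hwr hgapx hgr
  refine ⟨(inner ℝ w h, ‖perp w h‖, s), ⟨hk.perp_pos, hk.pos, ?_⟩, ?_⟩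
  · refine (solvesSystem_iff hpos hw hr ?_).2 ⟨rfl, norm_sq_eq_perp hwn h, hk.wL1_eq⟩
    exact (ae_eq_systemDirection_iff hpos hw hg hr hk.pos (hD _ hk.perp_pos) hk.wL1_eq rfl
      rfl).1 ⟨hk.abs_le, hk.inner_eq⟩
  · rintro ⟨c₁, c₂, s'⟩ ⟨h2, hs', hsol⟩
    simp only at h2 hs' hsol
    have hmem := memLp_systemDirection (ρ := ρ) (f := f) (ψ := ψ) (κ := κ) (c₁ := c₁) (c₂ := c₂)
      hs' hpos hw hg
    have hh := hmem.coeFn_toLp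
    set h' := hmem.toLp _
    obtain ⟨e1, e2, e3⟩ := (solvesSystem_iff hpos hw hr hh).1 hsol
    have e4 : ‖perp w h'‖ = c₂ := by
      rw [norm_sq_eq_perp hwn, e1, add_right_inj] at e2
      exact (sq_eq_sq₀ (norm_nonneg _) h2.le).1 e2
    obtain ⟨e5, e6⟩ := (ae_eq_systemDirection_iff hpos hw hg hr hs' (hD _ h2) e3 e1 e4).2 hh
    obtain ⟨rfl, rfl⟩ := IsKKT.unique hf_cont hf_range hκ hψ0 hwn hk
      ⟨e4 ▸ h2, hs', e5, e6, e3⟩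
    rw [e1, e4]
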